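/- Let K̂ be a 3×3 complex matrix with simple spectrum and one zero eigenvalue (so det K̂ = 0). For all choices of ⟨1| and of the inhomogeneities outside a proper algebraic subset, the SoV covectors ⟨h| and SoV vectors |h⟩, h ∈ {0,1,2}^N, form bases of H* and H respectively (in particular ⟨1| may be taken of tensor-product form with xyz ≠ 0, xz ≠ 0, or x ≠ 0 according to the three Jordan cases), and these two bases are mutually orthogonal: ⟨h|k⟩ = δ_{h,k}·N_h with N_h = ( ∏_{a=1}^N d(ξ_a^{(1)})/d(ξ_a^{(1+δ_{h_a,1}+δ_{h_a,2})}) ) · V(ξ₁,…,ξ_N)² / ( V(ξ₁^{(δ_{h₁,1}+δ_{h₁,2})},…,ξ_N^{(δ_{h_N,1}+δ_{h_N,2})}) · V(ξ₁^{(δ_{h₁,2})},…,ξ_N^{(δ_{h_N,2})}) ); equivalently the identity of H decomposes as Id = Σ_{h∈{0,1,2}^N} |h⟩⟨h| / N_h. -/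

import Mathlib

open scoped BigOperators

namespace SoV

noncomputable section

/-- Quantum states of the gl₃ chain of length `N`: labels of the natural tensor basis
of `H = (ℂ³)^{⊗N}`. -/
abbrev St (N : ℕ) := Fin N → Fin 3
/-- The Hilbert space `H` (and its dual), realized as functions on basis labels. -/
abbrev Hsp (N : ℕ) := St N → ℂ
/-- Operators on `H`. -/
abbrev Op (N : ℕ) := Matrix (St N) (St N) ℂ

variable {N : ℕ}

/-- ξᵢ − ξⱼ ∉ {0, η, −η} for i ≠ j. -/
def InhomCond (η : ℂ) (ξ : Fin N → ℂ) : Prop :=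
  ∀ i j : Fin N, i ≠ j → ξ i - ξ j ≠ 0 ∧ ξ i - ξ j ≠ η ∧ ξ i - ξ j ≠ -η

/-- Vandermonde product `V(x₁,…,x_M) = ∏_{i<j} (x_j − x_i)`. -/
def Vdm {M : ℕ} (x : Fin M → ℂ) : ℂ :=
  ∏ j : Fin M, ∏ i ∈ Finset.univ.filter (fun i => i < j), (x j - x i)

/-- `d(λ) = ∏_a (λ − ξ_a)`. -/
def dfun (ξ : Fin N → ℂ) (lam : ℂ) : ℂ := ∏ a, (lam - ξ a)

/-- The quantum determinant at identity twist:
`q-det M^{(I)}(λ) = ∏_b (λ−ξ_b+η)(λ−ξ_b−η)(λ−ξ_b−2η)`. -/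
def qdetI (η : ℂ) (ξ : Fin N → ℂ) (lam : ℂ) : ℂ :=
  ∏ b, ((lam - ξ b + η) * (lam - ξ b - η) * (lam - ξ b - 2 * η))

/-- The rational gl₃ R-matrix `R_{a,n}(λ − ξ_n) = (λ−ξ_n)·Id + η·P` acting on the
auxiliary space (first factor) and the `n`-th site of the chain. -/
def Raux (η : ℂ) (ξ : Fin N → ℂ) (lam : ℂ) (n : Fin N) :
    Matrix (Fin 3 × St N) (Fin 3 × St N) ℂ := Matrix.of fun p q =>
  (lam - ξ n) * (if p = q then 1 else 0) +
    η * (if p.1 = q.2 n ∧ p.2 = Function.update q.2 n q.1 then 1 else 0)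

/-- The twist matrix `K` acting on the auxiliary space. -/
def Kaux (K : Matrix (Fin 3) (Fin 3) ℂ) :
    Matrix (Fin 3 × St N) (Fin 3 × St N) ℂ := Matrix.of fun p q =>
  K p.1 q.1 * (if p.2 = q.2 then 1 else 0)

/-- The monodromy matrix `M^{(K)}(λ) = K_a R_{a,N}(λ−ξ_N) ⋯ R_{a,1}(λ−ξ_1)`. -/
def monodromy (η : ℂ) (ξ : Fin N → ℂ) (K : Matrix (Fin 3) (Fin 3) ℂ) (lam : ℂ) :
    Matrix (Fin 3 × St N) (Fin 3 × St N) ℂ :=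
  Kaux K * ((List.ofFn fun n : Fin N => Raux η ξ lam n).reverse.prod)

/-- The transfer matrix `T₁^{(K)}(λ) = tr_a M^{(K)}(λ)`. -/
def T1 (η : ℂ) (ξ : Fin N → ℂ) (K : Matrix (Fin 3) (Fin 3) ℂ) (lam : ℂ) : Op N :=
  Matrix.of fun f g => ∑ v : Fin 3, monodromy η ξ K lam (v, f) (v, g)

/-- Embedding of an (aux ⊗ H)-operator using the first of two auxiliary spaces. -/
def emb1 (M : Matrix (Fin 3 × St N) (Fin 3 × St N) ℂ) :
    Matrix ((Fin 3 × Fin 3) × St N) ((Fin 3 × Fin 3) × St N) ℂ := Matrix.of fun p q =>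
  M (p.1.1, p.2) (q.1.1, q.2) * (if p.1.2 = q.1.2 then 1 else 0)

/-- Embedding of an (aux ⊗ H)-operator using the second of two auxiliary spaces. -/
def emb2 (M : Matrix (Fin 3 × St N) (Fin 3 × St N) ℂ) :
    Matrix ((Fin 3 × Fin 3) × St N) ((Fin 3 × Fin 3) × St N) ℂ := Matrix.of fun p q =>
  M (p.1.2, p.2) (q.1.2, q.2) * (if p.1.1 = q.1.1 then 1 else 0)

/-- The antisymmetrizer `P⁻₁₂` on the two auxiliary spaces (acting trivially on `H`). -/
def antisym2 : Matrix ((Fin 3 × Fin 3) × St N) ((Fin 3 × Fin 3) × St N) ℂ :=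
  Matrix.of fun p q =>
    (if p.2 = q.2 then 1 else 0) *
      ((2 : ℂ)⁻¹ * ((if p.1 = q.1 then 1 else 0) - (if p.1 = (q.1.2, q.1.1) then 1 else 0)))

/-- The fused transfer matrix
`T₂^{(K)}(λ) = tr_{12} [P⁻₁₂ M₁^{(K)}(λ) M₂^{(K)}(λ−η)]`. -/
def T2 (η : ℂ) (ξ : Fin N → ℂ) (K : Matrix (Fin 3) (Fin 3) ℂ) (lam : ℂ) : Op N :=
  Matrix.of fun f g => ∑ v : Fin 3 × Fin 3,
    ((antisym2 * emb1 (monodromy η ξ K lam) * emb2 (monodromy η ξ K (lam - η)) :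
      Matrix ((Fin 3 × Fin 3) × St N) ((Fin 3 × Fin 3) × St N) ℂ)) (v, f) (v, g)

/-- A matrix has simple spectrum iff its minimal and characteristic polynomials coincide. -/
def SimpleSpectrum (K : Matrix (Fin 3) (Fin 3) ℂ) : Prop := minpoly ℂ K = K.charpoly

/-- The conserved-charge product `∏_n T₂^{(K)}(ξ_n−η)^{δ_{h_n,0}} T₁^{(K)}(ξ_n)^{δ_{h_n,2}}`
generating the SoV co-vector basis. -/
def sovCovOp (η : ℂ) (ξ : Fin N → ℂ) (K : Matrix (Fin 3) (Fin 3) ℂ) (h : St N) : Op N :=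
  (List.ofFn fun n : Fin N =>
    T2 η ξ K (ξ n - η) ^ (if h n = 0 then 1 else 0) *
      T1 η ξ K (ξ n) ^ (if h n = 2 then 1 else 0)).prod

/-- The SoV co-vector `⟨h| = ⟨1| ∏_n T₂^{(K)}(ξ_n−η)^{δ_{h_n,0}} T₁^{(K)}(ξ_n)^{δ_{h_n,2}}`. -/
def sovCov (η : ℂ) (ξ : Fin N → ℂ) (K : Matrix (Fin 3) (Fin 3) ℂ) (L : Hsp N) (h : St N) :
    Hsp N := Matrix.vecMul L (sovCovOp η ξ K h)

/-- The conserved-charge product `∏_n T₂^{(K)}(ξ_n)^{δ_{h_n,1}} T₁^{(K)}(ξ_n)^{δ_{h_n,2}}`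
generating the SoV vector basis. -/
def sovVecOp (η : ℂ) (ξ : Fin N → ℂ) (K : Matrix (Fin 3) (Fin 3) ℂ) (h : St N) : Op N :=
  (List.ofFn fun n : Fin N =>
    T2 η ξ K (ξ n) ^ (if h n = 1 then 1 else 0) *
      T1 η ξ K (ξ n) ^ (if h n = 2 then 1 else 0)).prod

/-- The SoV vector `|h⟩ = ∏_n T₂^{(K)}(ξ_n)^{δ_{h_n,1}} T₁^{(K)}(ξ_n)^{δ_{h_n,2}} |0⟩`. -/
def sovVec (η : ℂ) (ξ : Fin N → ℂ) (K : Matrix (Fin 3) (Fin 3) ℂ) (R0 : Hsp N) (h : St N) :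
    Hsp N := Matrix.mulVec (sovVecOp η ξ K h) R0

/-- Pairing ⟨L|v⟩ between a co-vector and a vector. -/
def pair (L v : Hsp N) : ℂ := ∑ f, L f * v f

/-- A family of `3^N` (co-)vectors is a basis of `H`. -/
def IsBasisFamily (v : St N → Hsp N) : Prop :=
  LinearIndependent ℂ v ∧ Submodule.span ℂ (Set.range v) = ⊤

/-- The label `(0,…,0)`. -/
def zeroSt : St N := fun _ => 0

/-- `R0` is the reference vector `|0⟩`, characterized by `⟨k|0⟩ = ∏_a δ_{k_a,0}`. -/
def DualRef (η : ℂ) (ξ : Fin N → ℂ) (K : Matrix (Fin 3) (Fin 3) ℂ) (L R0 : Hsp N) : Prop :=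
  ∀ k : St N, pair (sovCov η ξ K L k) R0 = if k = zeroSt then 1 else 0

/-- The diagonal SoV coupling `N_h`. -/
def Nh (η : ℂ) (ξ : Fin N → ℂ) (h : St N) : ℂ :=
  (∏ a, dfun ξ (ξ a - η) / dfun ξ (ξ a - ((1 : ℂ) + (if h a = 0 then 0 else 1)) * η)) *
    Vdm ξ ^ 2 /
      (Vdm (fun a => ξ a - (if h a = 0 then 0 else 1 : ℂ) * η) *
        Vdm (fun a => ξ a - (if h a = 2 then 1 else 0 : ℂ) * η))

/-- The 3×3 Jordan-type matrix with diagonal `(k₀,k₁,k₂)` and superdiagonal `(y₁,y₂)`. -/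
def KJmat (k₀ k₁ k₂ y₁ y₂ : ℂ) : Matrix (Fin 3) (Fin 3) ℂ := !![k₀, y₁, 0; 0, k₁, y₂; 0, 0, k₂]

/-- `W` conjugates `K` to its Jordan form with data `(k₀,k₁,k₂,y₁,y₂)`. -/
def JordanData (K W : Matrix (Fin 3) (Fin 3) ℂ) (k₀ k₁ k₂ y₁ y₂ : ℂ) : Prop :=
  IsUnit W.det ∧ K = W * KJmat k₀ k₁ k₂ y₁ y₂ * W⁻¹

/-- The tensor product co-vector `⟨L| = (⊗_a (x,y,z)_a)·Γ_W⁻¹`. -/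
def tensorCov (W : Matrix (Fin 3) (Fin 3) ℂ) (x y z : ℂ) : Hsp N :=
  fun f => ∏ a, Matrix.vecMul ![x, y, z] W⁻¹ (f a)

/-- The tensor product vector `|R⟩ = Γ_W·(⊗_a (r,s,t)_aᵗ)`. -/
def tensorVec (W : Matrix (Fin 3) (Fin 3) ℂ) (r s t : ℂ) : Hsp N :=
  fun f => ∏ a, Matrix.mulVec W ![r, s, t] (f a)

/-- `1_k = {a : k_a = 1}`. -/
def ones (k : St N) : Finset (Fin N) := Finset.univ.filter fun a => k a = 1

/-- `n_k = ⌊#1_k / 2⌋`. -/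
def nhalf (k : St N) : ℕ := (ones k).card / 2

/-- `k_{α,β}^{(0,2)}`: the label `k` with entries in `α` set to `0` and entries in `β` set to `2`. -/
def kab (k : St N) (α β : Finset (Fin N)) : St N :=
  fun a => if a ∈ α then 0 else if a ∈ β then 2 else k a

end
end SoV

namespace SoV
noncomputable section

section RowRelations

variable {A : Type*} [Ring A]

/-- The product of matrices with entries in `A`. -/
def mulE (B C : Fin 3 → Fin 3 → A) : Fin 3 → Fin 3 → A := fun i j => ∑ p, B i p * C p j

/-- All entries of `B` commute with all entries of `C`. -/
def CommE (B C : Fin 3 → Fin 3 → A) : Prop := ∀ i j k l, Commute (B i j) (C k l)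

lemma sum_swap_two (f : Fin 3 → Fin 3 → A) : ∑ p, ∑ q, f p q = ∑ p, ∑ q, f q p :=
  Finset.sum_comm

lemma mulE_mul_mulE {B C B' C' : Fin 3 → Fin 3 → A} (h : CommE C B') (i j k l : Fin 3) :
    mulE B C i j * mulE B' C' k l = ∑ p, ∑ q, B i p * B' k q * (C p j * C' q l) := by
  simp only [mulE, Finset.sum_mul_sum]
  refine Finset.sum_congr rfl fun p _ => Finset.sum_congr rfl fun q _ => ?_
  have := (h p j k q).eq
  calc _ = B i p * (C p j * B' k q) * C' q l := by simp only [mul_assoc]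
    _ = _ := by rw [this]; simp only [mul_assoc]

variable [Algebra ℂ A]

/-- The relation `R(s) B₁ B'₂ = B'₂ B₁ R(s)`, in components. -/
def RTT (s η : ℂ) (B B' : Fin 3 → Fin 3 → A) : Prop := ∀ i j k l,
  s • (B i j * B' k l) + η • (B k j * B' i l) = s • (B' k l * B i j) + η • (B' k j * B i l)

/-- Antisymmetrizing the rows of `B ⊗ B'` antisymmetrizes its columns. -/
def AntiPreserving (B B' : Fin 3 → Fin 3 → A) : Prop := ∀ i k p q,
  B i p * B' k q - B i q * B' k p = -(B k p * B' i q - B k q * B' i p)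

lemma RTT.mulE {s η : ℂ} {B C B' C' : Fin 3 → Fin 3 → A} (hB : RTT s η B B') (hC : RTT s η C C')
    (h1 : CommE C B') (h2 : CommE C' B) : RTT s η (mulE B C) (mulE B' C') := by
  intro i j k l
  rw [mulE_mul_mulE h1, mulE_mul_mulE h1, mulE_mul_mulE h2, mulE_mul_mulE h2]
  have e1 : s • ∑ p, ∑ q, B i p * B' k q * (C p j * C' q l)
      + η • ∑ p, ∑ q, B k p * B' i q * (C p j * C' q l)
      = ∑ p, ∑ q, (s • (B i p * B' k q) + η • (B k p * B' i q)) * (C p j * C' q l) := by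
    simp only [Finset.smul_sum, add_mul, Finset.sum_add_distrib, smul_mul_assoc]
  have e2 : ∑ p, ∑ q, (s • (B i p * B' k q) + η • (B k p * B' i q)) * (C p j * C' q l)
      = ∑ p, ∑ q, (s • (B' k q * B i p) + η • (B' k p * B i q)) * (C p j * C' q l) := by
    refine Finset.sum_congr rfl fun p _ => Finset.sum_congr rfl fun q _ => ?_
    rw [hB i p k q]
  have e3 : ∑ p, ∑ q, (s • (B' k q * B i p) + η • (B' k p * B i q)) * (C p j * C' q l)
      = ∑ p, ∑ q, B' k p * B i q * (s • (C q j * C' p l) + η • (C p j * C' q l)) := by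
    simp only [add_mul, mul_add, Finset.sum_add_distrib, smul_mul_assoc, mul_smul_comm]
    congr 1
    exact sum_swap_two _
  have e4 : ∑ p, ∑ q, B' k p * B i q * (s • (C q j * C' p l) + η • (C p j * C' q l))
      = ∑ p, ∑ q, B' k p * B i q * (s • (C' p l * C q j) + η • (C' p j * C q l)) := by
    refine Finset.sum_congr rfl fun p _ => Finset.sum_congr rfl fun q _ => ?_
    rw [hC q j p l]
  rw [e1, e2, e3, e4]
  simp only [mul_add, Finset.sum_add_distrib, mul_smul_comm, Finset.smul_sum]

lemma RTT.antiPreserving {η : ℂ} (hη : η ≠ 0) {B B' : Fin 3 → Fin 3 → A} (h : RTT η η B B') :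
    AntiPreserving B B' := by
  intro i k p q
  have h1 := h i p k q
  have h2 := h i q k p
  simp only [← smul_add] at h1 h2
  have h1 := smul_right_injective A hη h1
  have h2 := smul_right_injective A hη h2
  have h3 : B i p * B' k q + B k p * B' i q = B i q * B' k p + B k q * B' i p := by
    rw [h1, h2, add_comm]
  rw [neg_sub, sub_eq_sub_iff_add_eq_add, h3, add_comm]

lemma RTT.commute_trace {s η : ℂ} (hs : s ^ 2 ≠ η ^ 2) {B B' : Fin 3 → Fin 3 → A}
    (h : RTT s η B B') : Commute (∑ i, B i i) (∑ i, B' i i) := by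
  have key : (s ^ 2 - η ^ 2) • ((∑ i, B i i) * ∑ i, B' i i)
      = (s ^ 2 - η ^ 2) • ((∑ i, B' i i) * ∑ i, B i i) := by
    have e : ∀ i k, (s ^ 2 - η ^ 2) • (B i i * B' k k) = s ^ 2 • (B' k k * B i i)
        - η ^ 2 • (B' i i * B k k) + (s * η) • (B' k i * B i k) - (s * η) • (B' i k * B k i) := by
      intro i k
      have h1 := congrArg (s • ·) (h i i k k)
      have h2 := congrArg (η • ·) (h k i i k)
      simp only [smul_add, smul_smul] at h1 h2
      rw [sub_smul, pow_two, pow_two]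
      rw [mul_comm η s] at h2
      have h1' := eq_sub_of_add_eq h1
      have h2' := eq_sub_of_add_eq' h2
      rw [h1', h2']
      abel
    simp only [Finset.sum_mul_sum, Finset.smul_sum, e, Finset.sum_add_distrib,
      Finset.sum_sub_distrib]
    rw [sum_swap_two fun i k => (s * η) • (B' k i * B i k), add_sub_cancel_right,
      sum_swap_two fun i k => s ^ 2 • (B' k k * B i i)]
    simp only [sub_smul, Finset.sum_sub_distrib]
  exact smul_right_injective A (sub_ne_zero.2 hs) key

lemma sum_antisymm_left {B B' C : Fin 3 → Fin 3 → A} (h : AntiPreserving B B')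
    (hC : ∀ p q, C p q = -C q p) (i k : Fin 3) :
    ∑ p, ∑ q, B i p * B' k q * C p q = -∑ p, ∑ q, B k p * B' i q * C p q := by
  have two : ∀ i k, (2 : ℂ) • ∑ p, ∑ q, B i p * B' k q * C p q
      = ∑ p, ∑ q, (B i p * B' k q - B i q * B' k p) * C p q := by
    intro i k
    simp only [sub_mul, Finset.sum_sub_distrib]
    rw [sum_swap_two fun p q => B i q * B' k p * C p q, two_smul, sub_eq_add_neg,
      ← Finset.sum_neg_distrib]
    congr 1
    refine Finset.sum_congr rfl fun p _ => ?_
    rw [← Finset.sum_neg_distrib]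
    refine Finset.sum_congr rfl fun q _ => ?_
    rw [hC q p, mul_neg, neg_neg]
  apply smul_right_injective A (two_ne_zero (α := ℂ))
  simp only [smul_neg, two]
  simp only [h i k, neg_mul, Finset.sum_neg_distrib]

/-- The rows of `B ⊗ B'` are antisymmetric. -/
def RowAnti (B B' : Fin 3 → Fin 3 → A) : Prop := ∀ i j k l, B i j * B' k l = -(B k j * B' i l)

lemma RowAnti.mulE_right {B B' : Fin 3 → Fin 3 → A} (h : RowAnti B B') {C C' : Fin 3 → Fin 3 → A}
    (hc : CommE C B') : RowAnti (mulE B C) (mulE B' C') := by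
  intro i j k l
  rw [mulE_mul_mulE hc, mulE_mul_mulE hc, ← Finset.sum_neg_distrib]
  refine Finset.sum_congr rfl fun p _ => ?_
  rw [← Finset.sum_neg_distrib]
  refine Finset.sum_congr rfl fun q _ => ?_
  rw [h i p k q, neg_mul]

lemma RowAnti.mulE_left {C C' : Fin 3 → Fin 3 → A} (h : RowAnti C C') {B B' : Fin 3 → Fin 3 → A}
    (hB : AntiPreserving B B') (hc : CommE C B') : RowAnti (mulE B C) (mulE B' C') := by
  intro i j k l
  rw [mulE_mul_mulE hc, mulE_mul_mulE hc]
  exact sum_antisymm_left hB (C := fun p q => C p j * C' q l) (fun p q => h p j q l) i k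

/-- The columns of `B ⊗ B'` are symmetric. -/
def ColSymm (B B' : Fin 3 → Fin 3 → A) : Prop := ∀ i j k l, B i j * B' k l = B i l * B' k j

lemma ColSymm.mulE_left {C C' : Fin 3 → Fin 3 → A} (h : ColSymm C C') {B B' : Fin 3 → Fin 3 → A}
    (hc : CommE C B') : ColSymm (mulE B C) (mulE B' C') := by
  intro i j k l
  rw [mulE_mul_mulE hc, mulE_mul_mulE hc]
  refine Finset.sum_congr rfl fun p _ => Finset.sum_congr rfl fun q _ => ?_
  rw [h p j q l]

lemma ColSymm.mulE_right {B B' : Fin 3 → Fin 3 → A} (h : ColSymm B B') {C C' : Fin 3 → Fin 3 → A}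
    (hC : AntiPreserving C C') (hc : CommE C B') : ColSymm (mulE B C) (mulE B' C') := by
  intro i j k l
  rw [mulE_mul_mulE hc, mulE_mul_mulE hc, ← sub_eq_zero, ← Finset.sum_sub_distrib]
  simp only [← Finset.sum_sub_distrib, ← mul_sub]
  set D : Fin 3 → Fin 3 → A := fun p q => C p j * C' q l - C p l * C' q j with hD
  have hD' : ∀ p q, D p q = -D q p := fun p q => hC p q j l
  have e : ∑ p, ∑ q, B i p * B' k q * D p q = -∑ p, ∑ q, B i p * B' k q * D p q := by
    conv_lhs => rw [sum_swap_two]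
    rw [← Finset.sum_neg_distrib]
    refine Finset.sum_congr rfl fun p _ => ?_
    rw [← Finset.sum_neg_distrib]
    refine Finset.sum_congr rfl fun q _ => ?_
    rw [h i q k p, hD' q p, mul_neg]
  have e2 : (2 : ℂ) • ∑ p, ∑ q, B i p * B' k q * D p q = 0 := by
    rw [two_smul]; nth_rw 1 [e]; simp
  exact (smul_eq_zero.1 e2).resolve_left two_ne_zero

/-- The trace over the antisymmetric part of two auxiliary spaces. -/
def wedgeTrace (B B' : Fin 3 → Fin 3 → A) : A :=
  (2 : ℂ)⁻¹ • ∑ i, ∑ k, (B i i * B' k k - B k i * B' i k)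

lemma RowAnti.wedgeTrace_eq {B B' : Fin 3 → Fin 3 → A} (h : RowAnti B B') :
    wedgeTrace B B' = (∑ i, B i i) * ∑ i, B' i i := by
  have e : ∀ i k, B i i * B' k k - B k i * B' i k = (2 : ℂ) • (B i i * B' k k) := by
    intro i k; rw [h k i i k, sub_neg_eq_add, two_smul]
  simp only [wedgeTrace, e, ← Finset.smul_sum, Finset.sum_mul_sum, smul_smul]
  norm_num

lemma ColSymm.wedgeTrace_eq_zero {B B' : Fin 3 → Fin 3 → A} (h : ColSymm B B') :
    wedgeTrace B B' = 0 := by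
  simp only [wedgeTrace, Finset.sum_sub_distrib]
  rw [sum_swap_two fun i k => B i i * B' k k]
  simp only [h _ _ _ _, sub_self, smul_zero]

/-- A totally antisymmetric tensor contracted with a matrix of determinant zero vanishes. -/
lemma sum_antisymm_of_det_eq_zero {K : Matrix (Fin 3) (Fin 3) ℂ} (hK : K.det = 0)
    {Y : Fin 3 → Fin 3 → Fin 3 → A} (h1 : ∀ p q r, Y p q r = -Y q p r)
    (h2 : ∀ p q r, Y p q r = -Y p r q) (l m n : Fin 3) :
    ∑ p, ∑ q, ∑ r, (K l p * K m q * K n r) • Y p q r = 0 := by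
  have z : ∀ a : A, a = -a → a = 0 := fun a ha => by
    have : (2 : ℂ) • a = 0 := by rw [two_smul]; nth_rw 1 [ha]; simp
    exact (smul_eq_zero.1 this).resolve_left two_ne_zero
  have z1 : ∀ p r, Y p p r = 0 := fun p r => z _ (h1 p p r)
  have z2 : ∀ p q, Y p q q = 0 := fun p q => z _ (h2 p q q)
  have z3 : ∀ p q, Y p q p = 0 := fun p q => by rw [h1, z2, neg_zero]
  have a1 : Y 0 2 1 = -Y 0 1 2 := h2 _ _ _
  have a2 : Y 1 0 2 = -Y 0 1 2 := h1 _ _ _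
  have a3 : Y 1 2 0 = Y 0 1 2 := by rw [h2, a2, neg_neg]
  have a4 : Y 2 0 1 = Y 0 1 2 := by rw [h1, a1, neg_neg]
  have a5 : Y 2 1 0 = -Y 0 1 2 := by rw [h1, a3]
  simp only [Fin.sum_univ_three, z1, z2, z3, a1, a2, a3, a4, a5, smul_neg, smul_zero, add_zero,
    zero_add]
  rw [Matrix.det_fin_three] at hK
  trans (K l 0 * K m 1 * K n 2 - K l 0 * K m 2 * K n 1 - K l 1 * K m 0 * K n 2
    + K l 1 * K m 2 * K n 0 + K l 2 * K m 0 * K n 1 - K l 2 * K m 1 * K n 0) • Y 0 1 2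
  · module
  convert zero_smul ℂ (Y 0 1 2)
  fin_cases l <;> fin_cases m <;> fin_cases n <;> simp only [Fin.zero_eta, Fin.mk_one,
    Fin.reduceFinMk] <;> first
    | ring1
    | linear_combination (exp := 1) hK
    | linear_combination (exp := 1) -hK

lemma trace_mul_wedgeTrace_eq_zero {K : Matrix (Fin 3) (Fin 3) ℂ} (hK : K.det = 0)
    {B B' B'' : Fin 3 → Fin 3 → A} (h : RowAnti B B') (h' : AntiPreserving B' B'') :
    (∑ i, ∑ p, K i p • B p i) *
      wedgeTrace (fun i j => ∑ p, K i p • B' p j) (fun i j => ∑ p, K i p • B'' p j) = 0 := by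
  have e1 : wedgeTrace (fun i j => ∑ p, K i p • B' p j) (fun i j => ∑ p, K i p • B'' p j)
      = (2 : ℂ)⁻¹ • ∑ m, ∑ n, ∑ q, ∑ r,
        (K m q * K n r) • (B' q m * B'' r n - B' q n * B'' r m) := by
    rw [wedgeTrace]
    congr 1
    simp only [Finset.sum_sub_distrib, smul_sub, Finset.sum_mul_sum, smul_mul_smul_comm]
    congr 1
    exact sum_swap_two _
  rw [e1, mul_smul_comm, smul_eq_zero]
  right
  have e2 : (∑ l, ∑ p, K l p • B p l) * ∑ m, ∑ n, ∑ q, ∑ r,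
      (K m q * K n r) • (B' q m * B'' r n - B' q n * B'' r m)
      = ∑ l, ∑ m, ∑ n, ∑ p, ∑ q, ∑ r, (K l p * K m q * K n r) •
        (B p l * (B' q m * B'' r n - B' q n * B'' r m)) := by
    rw [Finset.sum_mul_sum]
    refine Finset.sum_congr rfl fun l _ => Finset.sum_congr rfl fun m _ => ?_
    rw [Finset.mul_sum]
    refine Finset.sum_congr rfl fun n _ => ?_
    rw [Finset.sum_mul]
    refine Finset.sum_congr rfl fun p _ => ?_
    simp only [Finset.mul_sum, smul_mul_smul_comm, mul_assoc]
  rw [e2]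
  refine Finset.sum_eq_zero fun l _ => Finset.sum_eq_zero fun m _ =>
    Finset.sum_eq_zero fun n _ => ?_
  refine sum_antisymm_of_det_eq_zero hK
    (Y := fun p q r => B p l * (B' q m * B'' r n - B' q n * B'' r m)) ?_ ?_ l m n
  · intro p q r
    simp only [mul_sub, ← mul_assoc]
    rw [h p l q m, h p l q n]
    simp only [neg_mul, neg_sub_neg, neg_sub]
  · intro p q r
    rw [h' q r m n, mul_neg]

end RowRelations
end
end SoV

namespace SoV
noncomputable section

section LocalLax

/-- The components of `c·Id + η·P` with respect to its first tensor factor. -/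
def lax (c η : ℂ) (i j : Fin 3) : Matrix (Fin 3) (Fin 3) ℂ :=
  (c * if i = j then 1 else 0) • 1 + η • Matrix.single j i 1

lemma lax_mul_lax (c c' η : ℂ) (i j k l : Fin 3) :
    lax c η i j * lax c' η k l = (c * c' * ((if i = j then 1 else 0) * if k = l then 1 else 0)) • 1
      + (c * η * if i = j then 1 else 0) • Matrix.single l k 1
      + (c' * η * if k = l then 1 else 0) • Matrix.single j i 1
      + (η * η * if i = l then 1 else 0) • Matrix.single j k 1 := by
  have h : Matrix.single j i (1 : ℂ) * Matrix.single l k 1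
      = (if i = l then (1 : ℂ) else 0) • Matrix.single j k 1 := by
    by_cases h : i = l
    · subst h; simp
    · simp [h]
  simp only [lax, add_mul, mul_add, smul_mul_smul_comm, h, one_mul, mul_one, smul_smul]
  module

lemma lax_rtt (c c' η : ℂ) : RTT (c - c') η (lax c η) (lax c' η) := by
  intro i j k l
  simp only [lax_mul_lax]
  module

lemma lax_rowAnti (η : ℂ) : RowAnti (lax 0 η) (lax (-η) η) := by
  intro i j k l
  simp only [lax_mul_lax]
  module

lemma lax_colSymm (η : ℂ) : ColSymm (lax η η) (lax 0 η) := by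
  intro i j k l
  simp only [lax_mul_lax]
  module

end LocalLax

section Sites

variable {N : ℕ}

/-- The tensor product of a family of one-site operators. -/
def tens : (Fin N → Matrix (Fin 3) (Fin 3) ℂ) →* Op N where
  toFun A := Matrix.of fun f g => ∏ m, A m (f m) (g m)
  map_one' := by
    ext f g
    simp only [Matrix.of_apply, Pi.one_apply, Matrix.one_apply, Finset.prod_ite_zero,
      Finset.prod_const_one, funext_iff, Finset.mem_univ, true_implies]
  map_mul' A B := by
    ext f g
    simp only [Matrix.of_apply, Pi.mul_apply, Matrix.mul_apply, ← Finset.prod_mul_distrib]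
    rw [Finset.prod_univ_sum]
    simp

lemma tens_apply (A : Fin N → Matrix (Fin 3) (Fin 3) ℂ) (f g : St N) :
    tens A f g = ∏ m, A m (f m) (g m) := rfl

lemma tens_mulSingle_apply (n : Fin N) (A : Matrix (Fin 3) (Fin 3) ℂ) (f g : St N) :
    tens (Pi.mulSingle n A) f g
      = A (f n) (g n) * ∏ m ∈ Finset.univ.erase n, (1 : Matrix (Fin 3) (Fin 3) ℂ) (f m) (g m) := by
  rw [tens_apply, ← Finset.mul_prod_erase _ _ (Finset.mem_univ n), Pi.mulSingle_eq_same]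
  congr 1
  refine Finset.prod_congr rfl fun m hm => ?_
  rw [Pi.mulSingle_eq_of_ne (Finset.ne_of_mem_erase hm)]

/-- A one-site operator acting on the `n`-th site. -/
def site (n : Fin N) : Matrix (Fin 3) (Fin 3) ℂ →ₐ[ℂ] Op N :=
  AlgHom.ofLinearMap
    { toFun := fun A => tens (Pi.mulSingle n A)
      map_add' := fun A B => by
        ext f g; simp only [Matrix.add_apply, tens_mulSingle_apply, add_mul]
      map_smul' := fun c A => by
        ext f g; simp [tens_mulSingle_apply, mul_assoc] }
    (by simp) (fun A B => by simp [Pi.mulSingle_mul])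

lemma site_eq (n : Fin N) (A : Matrix (Fin 3) (Fin 3) ℂ) : site n A = tens (Pi.mulSingle n A) := rfl

lemma site_apply (n : Fin N) (A : Matrix (Fin 3) (Fin 3) ℂ) (f g : St N) :
    site n A f g = if ∀ m, m ≠ n → f m = g m then A (f n) (g n) else 0 := by
  rw [site_eq, tens_mulSingle_apply]
  simp only [Matrix.one_apply, Finset.prod_ite_zero, Finset.prod_const_one]
  simp

lemma site_commute {m n : Fin N} (h : m ≠ n) (A B : Matrix (Fin 3) (Fin 3) ℂ) :
    Commute (site m A) (site n B) := by
  have := (Pi.mulSingle_commute (f := fun _ : Fin N => Matrix (Fin 3) (Fin 3) ℂ) h A B).map tens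
  exact this

/-- The components of an operator on `ℂ³ ⊗ H` with respect to the auxiliary space. -/
def ent (M : Matrix (Fin 3 × St N) (Fin 3 × St N) ℂ) (i j : Fin 3) : Op N :=
  Matrix.of fun f g => M (i, f) (j, g)

lemma ent_mul (M M' : Matrix (Fin 3 × St N) (Fin 3 × St N) ℂ) :
    ent (M * M') = mulE (ent M) (ent M') := by
  funext i j
  ext f g
  simp [ent, mulE, Matrix.mul_apply, Fintype.sum_prod_type, Matrix.sum_apply]

lemma ent_one (i j : Fin 3) :
    ent (1 : Matrix (Fin 3 × St N) (Fin 3 × St N) ℂ) i j = if i = j then 1 else 0 := by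
  ext f g
  by_cases h : i = j <;> simp [ent, Matrix.one_apply, h]

lemma ent_Kaux (K : Matrix (Fin 3) (Fin 3) ℂ) (i j : Fin 3) :
    ent (Kaux K : Matrix (Fin 3 × St N) (Fin 3 × St N) ℂ) i j = K i j • 1 := by
  ext f g
  simp [ent, Kaux, Matrix.one_apply]

lemma ent_Raux (η : ℂ) (ξ : Fin N → ℂ) (lam : ℂ) (n : Fin N) (i j : Fin 3) :
    ent (Raux η ξ lam n) i j = site n (lax (lam - ξ n) η i j) := by
  ext f g
  have e : f = Function.update g n j ↔ f n = j ∧ ∀ m, m ≠ n → f m = g m := by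
    rw [eq_comm, Function.update_eq_iff]
    simp only [eq_comm]
  have e2 : f = g ↔ f n = g n ∧ ∀ m, m ≠ n → f m = g m := by
    rw [eq_comm, ← Function.update_eq_self n g, Function.update_eq_iff]
    simp only [eq_comm, Function.update_eq_self]
  rw [site_apply]
  simp only [ent, Raux, Matrix.of_apply, Prod.mk.injEq, e, e2, lax, Matrix.add_apply,
    Matrix.smul_apply, Matrix.one_apply, Matrix.single_apply, smul_eq_mul]
  clear e e2
  by_cases hp : ∀ m, m ≠ n → f m = g m
  · rw [if_pos hp]
    simp only [eq_true hp, and_true]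
    have e3 : (j = f n ∧ i = g n) ↔ (i = g n ∧ f n = j) := by rw [and_comm, eq_comm (a := j)]
    simp only [e3]
    by_cases h1 : i = j <;> by_cases h2 : f n = g n <;> simp only [h1, h2, and_true,
      and_false, if_true, if_false, mul_one, mul_zero]
  · rw [if_neg hp]
    simp only [eq_false hp, and_false, if_false, mul_zero, add_zero]

lemma T1_eq (η : ℂ) (ξ : Fin N → ℂ) (K : Matrix (Fin 3) (Fin 3) ℂ) (lam : ℂ) :
    T1 η ξ K lam = ∑ i, ent (monodromy η ξ K lam) i i := by
  ext f g
  simp [T1, ent, Matrix.sum_apply]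

lemma emb1_mul_emb2_apply (M M' : Matrix (Fin 3 × St N) (Fin 3 × St N) ℂ) (i k j l : Fin 3)
    (f g : St N) :
    (emb1 M * emb2 M' : Matrix ((Fin 3 × Fin 3) × St N) ((Fin 3 × Fin 3) × St N) ℂ)
      ((i, k), f) ((j, l), g) = (ent M i j * ent M' k l) f g := by
  simp [Matrix.mul_apply, emb1, emb2, ent, Fintype.sum_prod_type, mul_ite, ite_mul]

lemma antisym2_mul_apply (X : Matrix ((Fin 3 × Fin 3) × St N) ((Fin 3 × Fin 3) × St N) ℂ)
    (i k : Fin 3) (f : St N) (q : (Fin 3 × Fin 3) × St N) :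
    (antisym2 * X : Matrix ((Fin 3 × Fin 3) × St N) ((Fin 3 × Fin 3) × St N) ℂ) ((i, k), f) q
      = 2⁻¹ * (X ((i, k), f) q - X ((k, i), f) q) := by
  simp only [Matrix.mul_apply, antisym2, Matrix.of_apply, Fintype.sum_prod_type, Prod.mk.injEq,
    ite_and, ite_mul, one_mul, zero_mul, mul_sub, sub_mul, mul_ite, mul_one, mul_zero,
    Finset.sum_sub_distrib, Finset.sum_ite_eq, Finset.mem_univ, if_true,
    Finset.sum_ite_irrel, Finset.sum_const_zero]

lemma T2_eq (η : ℂ) (ξ : Fin N → ℂ) (K : Matrix (Fin 3) (Fin 3) ℂ) (lam : ℂ) :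
    T2 η ξ K lam
      = wedgeTrace (ent (monodromy η ξ K lam)) (ent (monodromy η ξ K (lam - η))) := by
  ext f g
  simp only [T2, Matrix.of_apply, mul_assoc, antisym2_mul_apply, emb1_mul_emb2_apply,
    Fintype.sum_prod_type, wedgeTrace, Matrix.smul_apply, Matrix.sum_apply, Matrix.sub_apply,
    Finset.mul_sum, smul_eq_mul]

end Sites
end
end SoV

namespace SoV
noncomputable section

section CommEntries

variable {A : Type*} [Ring A]

lemma CommE.symm {B C : Fin 3 → Fin 3 → A} (h : CommE B C) : CommE C B :=
  fun i j k l => (h k l i j).symm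

lemma CommE.mulE_right {B C D : Fin 3 → Fin 3 → A} (h1 : CommE B C) (h2 : CommE B D) :
    CommE B (mulE C D) := fun i j k l =>
  Commute.sum_right _ _ _ fun p _ => (h1 i j k p).mul_right (h2 i j p l)

lemma CommE.mulE_left {B C D : Fin 3 → Fin 3 → A} (h1 : CommE B D) (h2 : CommE C D) :
    CommE (mulE B C) D := (CommE.mulE_right h1.symm h2.symm).symm

end CommEntries

section Chain

variable {N : ℕ}

lemma site_rtt (η : ℂ) (c c' : ℂ) (n : Fin N) :
    RTT (c - c') η (fun i j => site n (lax c η i j)) (fun i j => site n (lax c' η i j)) := by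
  intro i j k l
  simpa only [map_add, map_smul, map_mul] using congrArg (site n) (lax_rtt c c' η i j k l)

/-- The auxiliary components of the ordered product of R-matrices over a list of sites. -/
def chain (η : ℂ) (ξ : Fin N → ℂ) (l : List (Fin N)) (lam : ℂ) : Fin 3 → Fin 3 → Op N :=
  ent (l.map (Raux η ξ lam)).prod

variable (η : ℂ) (ξ : Fin N → ℂ)

lemma ent_Raux' (lam : ℂ) (n : Fin N) :
    ent (Raux η ξ lam n) = fun i j => site n (lax (lam - ξ n) η i j) := by
  funext i j; exact ent_Raux η ξ lam n i j

lemma chain_nil (lam : ℂ) : chain η ξ [] lam = fun i j => if i = j then 1 else 0 := by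
  funext i j; simp [chain, ent_one]

lemma chain_cons (a : Fin N) (l : List (Fin N)) (lam : ℂ) :
    chain η ξ (a :: l) lam = mulE (ent (Raux η ξ lam a)) (chain η ξ l lam) := by
  simp [chain, ent_mul]

lemma chain_append (l₁ l₂ : List (Fin N)) (lam : ℂ) :
    chain η ξ (l₁ ++ l₂) lam = mulE (chain η ξ l₁ lam) (chain η ξ l₂ lam) := by
  simp [chain, ent_mul]

lemma commE_Raux_chain {a : Fin N} {l : List (Fin N)} (h : a ∉ l) (lam mu : ℂ) :
    CommE (ent (Raux η ξ lam a)) (chain η ξ l mu) := by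
  induction l with
  | nil =>
    intro i j k l
    rw [chain_nil]
    beta_reduce
    split_ifs
    exacts [Commute.one_right _, Commute.zero_right _]
  | cons b l ih =>
    rw [List.mem_cons, not_or] at h
    rw [chain_cons]
    refine CommE.mulE_right (fun i j k l => ?_) (ih h.2)
    rw [ent_Raux, ent_Raux]
    exact site_commute h.1 _ _

lemma chain_rtt {l : List (Fin N)} (h : l.Nodup) (lam mu : ℂ) :
    RTT (lam - mu) η (chain η ξ l lam) (chain η ξ l mu) := by
  induction l with
  | nil =>
    intro i j k l
    simp only [chain_nil, mul_ite, mul_one, mul_zero, ← ite_and]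
    simp only [and_comm]
  | cons a l ih =>
    rw [List.nodup_cons] at h
    rw [chain_cons, chain_cons]
    refine RTT.mulE ?_ (ih h.2) (commE_Raux_chain η ξ h.1 _ _).symm
      (commE_Raux_chain η ξ h.1 _ _).symm
    rw [ent_Raux', ent_Raux', show lam - mu = lam - ξ a - (mu - ξ a) by ring]
    exact site_rtt η _ _ a

lemma chain_antiPreserving (hη : η ≠ 0) {l : List (Fin N)} (h : l.Nodup) {lam mu : ℂ}
    (e : lam - mu = η) : AntiPreserving (chain η ξ l lam) (chain η ξ l mu) :=
  RTT.antiPreserving hη (by have := chain_rtt η ξ h lam mu; rwa [e] at this)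

lemma commE_chain {l₁ l₂ : List (Fin N)} (h : l₁.Disjoint l₂) (lam mu : ℂ) :
    CommE (chain η ξ l₁ lam) (chain η ξ l₂ mu) := by
  induction l₁ with
  | nil =>
    intro i j k l
    rw [chain_nil]
    beta_reduce
    split_ifs
    exacts [Commute.one_left _, Commute.zero_left _]
  | cons b l ih =>
    rw [List.disjoint_cons_left] at h
    rw [chain_cons]
    exact CommE.mulE_left (commE_Raux_chain η ξ h.1 _ _) (ih h.2)

lemma chain_rowAnti (hη : η ≠ 0) {l : List (Fin N)} (h : l.Nodup) {a : Fin N} (ha : a ∈ l) :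
    RowAnti (chain η ξ l (ξ a)) (chain η ξ l (ξ a - η)) := by
  obtain ⟨l₁, l₂, rfl⟩ := List.append_of_mem ha
  have h' := List.nodup_append'.1 h
  have h2 := List.nodup_cons.1 h'.2.1
  rw [chain_append, chain_append]
  refine RowAnti.mulE_left ?_ (chain_antiPreserving η ξ hη h'.1 (by ring))
    (commE_chain η ξ h'.2.2.symm _ _)
  rw [chain_cons, chain_cons]
  refine RowAnti.mulE_right ?_ (commE_Raux_chain η ξ h2.1 _ _).symm
  rw [ent_Raux', ent_Raux', sub_self, show ξ a - η - ξ a = -η by ring]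
  intro i j k l
  simpa only [map_neg, map_mul] using congrArg (site a) (lax_rowAnti η i j k l)

lemma chain_colSymm (hη : η ≠ 0) {l : List (Fin N)} (h : l.Nodup) {a : Fin N} (ha : a ∈ l) :
    ColSymm (chain η ξ l (ξ a + η)) (chain η ξ l (ξ a)) := by
  obtain ⟨l₁, l₂, rfl⟩ := List.append_of_mem ha
  have h' := List.nodup_append'.1 h
  have h2 := List.nodup_cons.1 h'.2.1
  rw [chain_append, chain_append]
  refine ColSymm.mulE_left ?_ (commE_chain η ξ h'.2.2.symm _ _)
  rw [chain_cons, chain_cons]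
  refine ColSymm.mulE_right ?_ (chain_antiPreserving η ξ hη h2.2 (by ring))
    (commE_Raux_chain η ξ h2.1 _ _).symm
  rw [ent_Raux', ent_Raux', sub_self, show ξ a + η - ξ a = η by ring]
  intro i j k l
  simpa only [map_mul] using congrArg (site a) (lax_colSymm η i j k l)

variable (K : Matrix (Fin 3) (Fin 3) ℂ)

/-- The sites in the order in which they enter the monodromy matrix. -/
def sites (N : ℕ) : List (Fin N) := (List.finRange N).reverse

lemma nodup_sites : (sites N).Nodup := List.nodup_reverse.2 (List.nodup_finRange N)

lemma mem_sites (a : Fin N) : a ∈ sites N := List.mem_reverse.2 (List.mem_finRange a)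

lemma ent_monodromy (lam : ℂ) :
    ent (monodromy η ξ K lam) = mulE (ent (Kaux K)) (chain η ξ (sites N) lam) := by
  rw [monodromy, ent_mul, chain, sites, List.map_reverse, List.ofFn_eq_map]

lemma ent_monodromy_apply (lam : ℂ) (i j : Fin 3) :
    ent (monodromy η ξ K lam) i j = ∑ p, K i p • chain η ξ (sites N) lam p j := by
  rw [ent_monodromy, mulE]
  simp [ent_Kaux]

lemma commE_Kaux (C : Fin 3 → Fin 3 → Op N) : CommE (ent (Kaux K)) C := fun i j k l => by
  rw [ent_Kaux]
  exact (Commute.one_left _).smul_left _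

lemma Kaux_rtt (s : ℂ) : RTT s η (ent (Kaux K : Matrix (Fin 3 × St N) (Fin 3 × St N) ℂ))
    (ent (Kaux K)) := by
  intro i j k l
  simp only [ent_Kaux, smul_mul_smul_comm, smul_smul, mul_comm]

lemma monodromy_rtt (lam mu : ℂ) :
    RTT (lam - mu) η (ent (monodromy η ξ K lam)) (ent (monodromy η ξ K mu)) := by
  rw [ent_monodromy, ent_monodromy]
  exact RTT.mulE (Kaux_rtt η K _) (chain_rtt η ξ nodup_sites lam mu) (commE_Kaux K _).symm
    (commE_Kaux K _).symm

lemma T1_commute {lam mu : ℂ} (h : (lam - mu) ^ 2 ≠ η ^ 2) :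
    Commute (T1 η ξ K lam) (T1 η ξ K mu) := by
  rw [T1_eq, T1_eq]
  exact RTT.commute_trace h (monodromy_rtt η ξ K lam mu)

lemma T1_mul_T1 (hη : η ≠ 0) (a : Fin N) :
    T1 η ξ K (ξ a) * T1 η ξ K (ξ a - η) = T2 η ξ K (ξ a) := by
  rw [T1_eq, T1_eq, T2_eq]
  refine (RowAnti.wedgeTrace_eq ?_).symm
  rw [ent_monodromy, ent_monodromy]
  exact RowAnti.mulE_left (chain_rowAnti η ξ hη nodup_sites (mem_sites a))
    (RTT.antiPreserving hη (Kaux_rtt η K _)) (commE_Kaux K _).symm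

lemma T1_mul_T2 (hη : η ≠ 0) (hK : K.det = 0) (a : Fin N) :
    T1 η ξ K (ξ a) * T2 η ξ K (ξ a - η) = 0 := by
  rw [T1_eq, T2_eq]
  have e : ∀ lam, ent (monodromy η ξ K lam)
      = fun i j => ∑ p, K i p • chain η ξ (sites N) lam p j := fun lam => by
    funext i j; exact ent_monodromy_apply η ξ K lam i j
  rw [e, e, e]
  exact trace_mul_wedgeTrace_eq_zero hK (chain_rowAnti η ξ hη nodup_sites (mem_sites a))
    (chain_antiPreserving η ξ hη nodup_sites (by ring))

lemma T2_add_eq_zero (hη : η ≠ 0) (a : Fin N) : T2 η ξ K (ξ a + η) = 0 := by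
  rw [T2_eq, add_sub_cancel_right]
  apply ColSymm.wedgeTrace_eq_zero
  rw [ent_monodromy, ent_monodromy]
  exact ColSymm.mulE_left (chain_colSymm η ξ hη nodup_sites (mem_sites a)) (commE_Kaux K _).symm

end Chain
end
end SoV

namespace SoV
noncomputable section

section PolynomialDependence

open Polynomial

/-- `f` is a polynomial function of degree at most `d` with coefficient `c` in degree `d`. -/
def PL (f : ℂ → ℂ) (d : ℕ) (c : ℂ) : Prop :=
  ∃ p : ℂ[X], p.natDegree ≤ d ∧ p.coeff d = c ∧ ∀ t, f t = p.eval t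

lemma PL.const (c : ℂ) : PL (fun _ => c) 0 c := ⟨C c, by simp, by simp, by simp⟩

lemma PL.linear (a b : ℂ) : PL (fun t => a * t + b) 1 a :=
  ⟨C a * X + C b, natDegree_linear_le, by simp [coeff_C], by simp⟩

lemma PL.of_le {f : ℂ → ℂ} {d : ℕ} {c : ℂ} (h : PL f d c) {e : ℕ} (he : d < e) : PL f e 0 := by
  obtain ⟨p, h1, -, h3⟩ := h
  exact ⟨p, h1.trans he.le, coeff_eq_zero_of_natDegree_lt (h1.trans_lt he), h3⟩

lemma PL.add {f g : ℂ → ℂ} {d : ℕ} {a b : ℂ} (hf : PL f d a) (hg : PL g d b) :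
    PL (fun t => f t + g t) d (a + b) := by
  obtain ⟨p, h1, h2, h3⟩ := hf
  obtain ⟨q, k1, k2, k3⟩ := hg
  exact ⟨p + q, (natDegree_add_le_of_le h1 k1).trans (max_self d).le, by simp [h2, k2],
    fun t => by simp [h3, k3]⟩

lemma PL.mul {f g : ℂ → ℂ} {d e : ℕ} {a b : ℂ} (hf : PL f d a) (hg : PL g e b) :
    PL (fun t => f t * g t) (d + e) (a * b) := by
  obtain ⟨p, h1, h2, h3⟩ := hf
  obtain ⟨q, k1, k2, k3⟩ := hg
  exact ⟨p * q, natDegree_mul_le_of_le h1 k1,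
    by rw [coeff_mul_add_eq_of_natDegree_le h1 k1, h2, k2],
    fun t => by simp [h3, k3]⟩

lemma PL.const_mul {f : ℂ → ℂ} {d : ℕ} {a : ℂ} (c : ℂ) (hf : PL f d a) :
    PL (fun t => c * f t) d (c * a) := by
  simpa using (PL.const c).mul hf

lemma PL.sub {f g : ℂ → ℂ} {d : ℕ} {a b : ℂ} (hf : PL f d a) (hg : PL g d b) :
    PL (fun t => f t - g t) d (a - b) := by
  simpa [sub_eq_add_neg] using hf.add (hg.const_mul (-1))

lemma PL.sum {ι : Type*} {s : Finset ι} {f : ι → ℂ → ℂ} {d : ℕ} {a : ι → ℂ}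
    (h : ∀ i ∈ s, PL (f i) d (a i)) : PL (fun t => ∑ i ∈ s, f i t) d (∑ i ∈ s, a i) := by
  classical
  induction s using Finset.induction_on with
  | empty => exact ⟨0, by simp, by simp, by simp⟩
  | insert i s hi ih =>
    simp only [Finset.sum_insert hi]
    exact (h i (Finset.mem_insert_self i s)).add
      (ih fun j hj => h j (Finset.mem_insert_of_mem hj))

lemma PL.prod {ι : Type*} {s : Finset ι} {f : ι → ℂ → ℂ} {d : ι → ℕ} {a : ι → ℂ}
    (h : ∀ i ∈ s, PL (f i) (d i) (a i)) :
    PL (fun t => ∏ i ∈ s, f i t) (∑ i ∈ s, d i) (∏ i ∈ s, a i) := by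
  classical
  induction s using Finset.induction_on with
  | empty => simpa using PL.const 1
  | insert i s hi ih =>
    simp only [Finset.prod_insert hi, Finset.sum_insert hi]
    exact (h i (Finset.mem_insert_self i s)).mul
      (ih fun j hj => h j (Finset.mem_insert_of_mem hj))

lemma PL.ne_zero {f : ℂ → ℂ} {d : ℕ} {a : ℂ} (h : PL f d a) (ha : a ≠ 0) : ∃ t, f t ≠ 0 := by
  obtain ⟨p, -, h2, h3⟩ := h
  by_contra! hf
  apply ha
  have hp : p = 0 := Polynomial.funext fun t => by rw [← h3, hf, eval_zero]
  rw [← h2, hp, coeff_zero]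

lemma PL.interpolate {f : ℂ → ℂ} {ι : Type*} [Fintype ι] [DecidableEq ι] {a : ℂ}
    (hf : PL f (Fintype.card ι) a) {z : ι → ℂ} (hz : Function.Injective z) (t : ℂ) :
    f t = a * ∏ b, (t - z b)
      + ∑ b, (∏ c ∈ Finset.univ.erase b, (t - z c) / (z b - z c)) * f (z b) := by
  obtain ⟨p, h1, h2, h3⟩ := hf
  set m : ℂ[X] := ∏ b, (X - C (z b)) with hm
  have hmon : m.Monic := monic_prod_of_monic _ _ fun b _ => monic_X_sub_C (z b)
  have hdeg : m.natDegree = Fintype.card ι := by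
    rw [hm, natDegree_finsetProd_X_sub_C_eq_card, Finset.card_univ]
  have hlt : (p - C a * m).degree < (Finset.univ : Finset ι).card := by
    rw [Finset.card_univ, degree_lt_iff_coeff_zero]
    intro k hk
    rw [coeff_sub, coeff_C_mul]
    rcases hk.eq_or_lt with rfl | hk
    · rw [h2, ← hdeg, hmon.coeff_natDegree, mul_one, sub_self]
    · rw [coeff_eq_zero_of_natDegree_lt (h1.trans_lt hk),
        coeff_eq_zero_of_natDegree_lt (hdeg.trans_lt hk), mul_zero, sub_zero]
  have key := Lagrange.eq_interpolate_of_eval_eq (r := fun b => f (z b)) hz.injOn hlt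
    (fun b _ => by
      have : m.eval (z b) = 0 := by
        rw [hm, eval_prod]; exact Finset.prod_eq_zero (Finset.mem_univ b) (by simp)
      simp [this, h3])
  have key2 := congrArg (eval t) key
  rw [eval_sub, eval_mul, eval_C, hm, eval_prod, ← h3, sub_eq_iff_eq_add'] at key2
  rw [key2, Lagrange.interpolate_apply, eval_finsetSum]
  simp only [eval_sub, eval_X, eval_C, eval_mul, Lagrange.basis, eval_prod, Lagrange.basisDivisor]
  congr 1
  refine Finset.sum_congr rfl fun b _ => ?_
  rw [mul_comm]
  congr 1
  refine Finset.prod_congr rfl fun c _ => ?_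
  rw [div_eq_inv_mul]

variable {ι κ τ : Type*}

/-- The entries of `F` are polynomial functions of degree at most `d`, with `C` the matrix of
coefficients in degree `d`. -/
def MPL (F : ℂ → Matrix ι κ ℂ) (d : ℕ) (C : Matrix ι κ ℂ) : Prop :=
  ∀ i j, PL (fun t => F t i j) d (C i j)

lemma MPL.const (C : Matrix ι κ ℂ) : MPL (fun _ => C) 0 C := fun i j => PL.const (C i j)

lemma MPL.mul [Fintype κ] {F : ℂ → Matrix ι κ ℂ} {G : ℂ → Matrix κ τ ℂ} {d e : ℕ}
    {C : Matrix ι κ ℂ} {D : Matrix κ τ ℂ} (hF : MPL F d C) (hG : MPL G e D) :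
    MPL (fun t => F t * G t) (d + e) (C * D) := fun i j => by
  simp only [Matrix.mul_apply]
  exact PL.sum fun k _ => (hF i k).mul (hG k j)

lemma MPL.sub {F G : ℂ → Matrix ι κ ℂ} {d : ℕ} {C D : Matrix ι κ ℂ} (hF : MPL F d C)
    (hG : MPL G d D) : MPL (fun t => F t - G t) d (C - D) := fun i j => (hF i j).sub (hG i j)

lemma MPL.smul {F : ℂ → Matrix ι κ ℂ} {d : ℕ} {C : Matrix ι κ ℂ} (c : ℂ) (hF : MPL F d C) :
    MPL (fun t => c • F t) d (c • C) := fun i j => (hF i j).const_mul c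

lemma MPL.sum {σ : Type*} {s : Finset σ} {F : σ → ℂ → Matrix ι κ ℂ} {d : ℕ}
    {C : σ → Matrix ι κ ℂ} (h : ∀ a ∈ s, MPL (F a) d (C a)) :
    MPL (fun t => ∑ a ∈ s, F a t) d (∑ a ∈ s, C a) := fun i j => by
  simp only [Matrix.sum_apply]
  exact PL.sum fun a ha => h a ha i j

lemma MPL.list_prod [Fintype ι] [DecidableEq ι] {σ : Type*} {F : σ → ℂ → Matrix ι ι ℂ}
    {d : σ → ℕ} {C : σ → Matrix ι ι ℂ} (l : List σ) (h : ∀ a ∈ l, MPL (F a) (d a) (C a)) :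
    MPL (fun t => (l.map fun a => F a t).prod) (l.map d).sum (l.map C).prod := by
  induction l with
  | nil => exact MPL.const 1
  | cons a l ih =>
    simp only [List.map_cons, List.prod_cons, List.sum_cons]
    exact (h a List.mem_cons_self).mul (ih fun b hb => h b (List.mem_cons_of_mem a hb))

lemma MPL.interpolate {F : ℂ → Matrix ι κ ℂ} [Fintype τ] [DecidableEq τ] {C : Matrix ι κ ℂ}
    {d : ℕ} (hF : MPL F d C) (hd : Fintype.card τ = d) {z : τ → ℂ} (hz : Function.Injective z)
    (t : ℂ) :
    F t = (∏ b, (t - z b)) • C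
      + ∑ b, (∏ c ∈ Finset.univ.erase b, (t - z c) / (z b - z c)) • F (z b) := by
  subst hd
  ext i j
  simp only [Matrix.add_apply, Matrix.smul_apply, Matrix.sum_apply, smul_eq_mul]
  rw [(hF i j).interpolate hz t, mul_comm (C i j)]

end PolynomialDependence

section TransferMatrices

variable {N : ℕ} {η : ℂ} {K : Matrix (Fin 3) (Fin 3) ℂ}

lemma MPL.ent {M : ℂ → Matrix (Fin 3 × St N) (Fin 3 × St N) ℂ} {d : ℕ}
    {C : Matrix (Fin 3 × St N) (Fin 3 × St N) ℂ} (h : MPL M d C) (i j : Fin 3) :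
    MPL (fun t => SoV.ent (M t) i j) d (SoV.ent C i j) := fun f g => h (i, f) (j, g)

lemma MPL.monodromy {ξ : ℂ → Fin N → ℂ} {lam : ℂ → ℂ} {e : Fin N → ℕ}
    {C : Fin N → Matrix (Fin 3 × St N) (Fin 3 × St N) ℂ}
    (h : ∀ n, MPL (fun t => Raux η (ξ t) (lam t) n) (e n) (C n)) :
    MPL (fun t => SoV.monodromy η (ξ t) K (lam t)) (∑ n, e n)
      (Kaux K * ((sites N).map C).prod) := by
  have := (MPL.const (Kaux K)).mul (MPL.list_prod (sites N) fun n _ => h n)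
  have e1 : ((sites N).map e).sum = ∑ n, e n := by
    rw [sites, List.map_reverse, List.sum_reverse, ← List.ofFn_eq_map, List.sum_ofFn]
  rw [zero_add, e1] at this
  simp only [SoV.monodromy, List.ofFn_eq_map, ← List.map_reverse]
  exact this

lemma MPL.T1 {ξ : ℂ → Fin N → ℂ} {lam : ℂ → ℂ} {e : Fin N → ℕ}
    {C : Fin N → Matrix (Fin 3 × St N) (Fin 3 × St N) ℂ}
    (h : ∀ n, MPL (fun t => Raux η (ξ t) (lam t) n) (e n) (C n)) :
    MPL (fun t => SoV.T1 η (ξ t) K (lam t)) (∑ n, e n)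
      (∑ i, SoV.ent (Kaux K * ((sites N).map C).prod) i i) := by
  simp only [T1_eq]
  exact MPL.sum fun i _ => (MPL.monodromy h).ent i i

lemma MPL.T2 {ξ : ℂ → Fin N → ℂ} {lam : ℂ → ℂ} {e e' : Fin N → ℕ}
    {C C' : Fin N → Matrix (Fin 3 × St N) (Fin 3 × St N) ℂ}
    (h : ∀ n, MPL (fun t => Raux η (ξ t) (lam t) n) (e n) (C n))
    (h' : ∀ n, MPL (fun t => Raux η (ξ t) (lam t - η) n) (e' n) (C' n)) :
    MPL (fun t => SoV.T2 η (ξ t) K (lam t)) (∑ n, e n + ∑ n, e' n)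
      (wedgeTrace (SoV.ent (Kaux K * ((sites N).map C).prod))
        (SoV.ent (Kaux K * ((sites N).map C').prod))) := by
  simp only [T2_eq, wedgeTrace]
  exact MPL.smul _ <| MPL.sum fun i _ => MPL.sum fun k _ =>
    (((MPL.monodromy h).ent i i).mul ((MPL.monodromy h').ent k k)).sub
      (((MPL.monodromy h).ent k i).mul ((MPL.monodromy h').ent i k))

lemma MPL.Raux {ξ : ℂ → Fin N → ℂ} {lam : ℂ → ℂ} {n : Fin N} {a b : ℂ}
    (h : ∀ t, lam t - ξ t n = a * t + b) :
    MPL (fun t => SoV.Raux η (ξ t) (lam t) n) 1 (a • 1) := fun p q => by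
  simp only [SoV.Raux, Matrix.of_apply, h, Matrix.smul_apply, Matrix.one_apply, smul_eq_mul]
  have := ((PL.linear a b).mul (PL.const (if p = q then 1 else 0))).add
    ((PL.const (η * (if p.1 = q.2 n ∧ p.2 = Function.update q.2 n q.1 then 1 else 0))).of_le
      zero_lt_one)
  simpa using this

lemma MPL.Raux_spectral (ξ : Fin N → ℂ) (c : ℂ) (n : Fin N) :
    MPL (fun t => SoV.Raux η ξ (t - c) n) 1 1 := by
  have := MPL.Raux (η := η) (ξ := fun _ => ξ) (lam := fun t => t - c) (n := n) (a := 1)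
    (b := -c - ξ n) fun t => by ring
  rwa [one_smul] at this

lemma MPL.T1_spectral (ξ : Fin N → ℂ) : MPL (SoV.T1 η ξ K) N (K.trace • 1) := by
  have := MPL.T1 (K := K) (ξ := fun _ => ξ) (MPL.Raux_spectral (η := η) ξ 0)
  convert this using 1
  · simp
  · simp
  · simp [ent_Kaux, Matrix.trace, ← Finset.sum_smul]

lemma MPL.T2_spectral (ξ : Fin N → ℂ) :
    ∃ c : ℂ, MPL (SoV.T2 η ξ K) (N + N) (c • 1) := by
  have := MPL.T2 (K := K) (ξ := fun _ => ξ) (lam := fun t => t - 0)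
    (MPL.Raux_spectral (η := η) ξ 0)
    (fun n => by simpa using MPL.Raux_spectral (η := η) ξ η n)
  refine ⟨2⁻¹ * ∑ i, ∑ k, (K i i * K k k - K k i * K i k), ?_⟩
  convert this using 1
  · simp
  · simp
  · simp [wedgeTrace, ent_Kaux, smul_smul, ← Finset.sum_smul, ← sub_smul]
    congr 1 <;> exact Finset.sum_comm

end TransferMatrices
end
end SoV

namespace SoV
noncomputable section

section CommutativeModel

variable {N : ℕ} {η : ℂ} {ξ : Fin N → ℂ}

/-- The inhomogeneities shifted by `-η` on the set `Z`. -/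
def shiftOn (η : ℂ) (ξ : Fin N → ℂ) (Z : Finset (Fin N)) (b : Fin N) : ℂ :=
  ξ b - if b ∈ Z then η else 0

lemma InhomCond.shiftOn_injective (h : InhomCond η ξ) (Z : Finset (Fin N)) :
    Function.Injective (shiftOn η ξ Z) := by
  intro b c hbc
  by_contra hne
  obtain ⟨h1, h2, h3⟩ := h b c hne
  simp only [shiftOn] at hbc
  split_ifs at hbc
  · exact h1 (by linear_combination hbc)
  · exact h2 (by linear_combination hbc)
  · exact h3 (by linear_combination hbc)
  · exact h1 (by linear_combination hbc)

lemma InhomCond.sumElim_shiftOn_injective (hη : η ≠ 0) (h : InhomCond η ξ)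
    (h2 : ∀ a b, ξ a - ξ b - 2 * η ≠ 0) (Z : Finset (Fin N)) :
    Function.Injective (Sum.elim (fun b => ξ b + η) (shiftOn η ξ Z)) := by
  refine Function.Injective.sumElim (fun b c hbc => ?_) (h.shiftOn_injective Z) fun b c hbc => ?_
  · by_contra hne
    exact (h b c hne).1 (by linear_combination hbc)
  · simp only [shiftOn] at hbc
    split_ifs at hbc
    · exact h2 c b (by linear_combination -hbc)
    · rcases eq_or_ne b c with rfl | hne
      · exact hη (by linear_combination hbc)
      · exact (h b c hne).2.2 (by linear_combination hbc)

/-- The values at `t` of the Lagrange basis polynomials of the nodes `z`. -/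
def lagr {ι : Type*} [Fintype ι] [DecidableEq ι] (z : ι → ℂ) (t : ℂ) (b : ι) : ℂ :=
  ∏ c ∈ Finset.univ.erase b, (t - z c) / (z b - z c)

lemma lagr_sumElim_inr {ι κ : Type*} [Fintype ι] [DecidableEq ι] [Fintype κ] [DecidableEq κ]
    (z : ι → ℂ) (z' : κ → ℂ) (t : ℂ) (b : κ) :
    lagr (Sum.elim z z') t (Sum.inr b) = (∏ c, (t - z c) / (z' b - z c)) * lagr z' t b := by
  have : (Finset.univ : Finset (ι ⊕ κ)).erase (Sum.inr b)
      = Finset.disjSum Finset.univ (Finset.univ.erase b) := by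
    ext c; cases c <;> simp
  rw [lagr, this, Finset.prod_disjSum]
  simp [lagr]

lemma T1_interpolate (h : InhomCond η ξ) (K : Matrix (Fin 3) (Fin 3) ℂ) (Z : Finset (Fin N))
    (t : ℂ) : T1 η ξ K t = ((∏ b, (t - shiftOn η ξ Z b)) * K.trace) • 1
      + ∑ b, lagr (shiftOn η ξ Z) t b • T1 η ξ K (shiftOn η ξ Z b) := by
  rw [(MPL.T1_spectral ξ).interpolate (Fintype.card_fin N) (h.shiftOn_injective Z) t, smul_smul]
  rfl

lemma T2_interpolate (hη : η ≠ 0) (h : InhomCond η ξ) (h2 : ∀ a b, ξ a - ξ b - 2 * η ≠ 0)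
    (K : Matrix (Fin 3) (Fin 3) ℂ) : ∃ β : Finset (Fin N) → ℂ → ℂ, ∀ Z t,
      T2 η ξ K t = β Z t • 1 + ∑ b, ((∏ c, (t - (ξ c + η)) / (shiftOn η ξ Z b - (ξ c + η))) *
        lagr (shiftOn η ξ Z) t b) • T2 η ξ K (shiftOn η ξ Z b) := by
  obtain ⟨σ, hσ⟩ := MPL.T2_spectral (η := η) (K := K) ξ
  refine ⟨fun Z t => (∏ b, (t - Sum.elim (fun b => ξ b + η) (shiftOn η ξ Z) b)) * σ,
    fun Z t => ?_⟩
  rw [hσ.interpolate (by simp) (h.sumElim_shiftOn_injective hη h2 Z) t, smul_smul,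
    Fintype.sum_sum_type]
  simp only [Sum.elim_inl, T2_add_eq_zero η ξ K hη, smul_zero, Finset.sum_const_zero, zero_add,
    Sum.elim_inr]
  congr 1
  refine Finset.sum_congr rfl fun b _ => ?_
  rw [← lagr_sumElim_inr]
  rfl

open scoped IsMulCommutative in
/-- The transfer matrices generate a commutative algebra. -/
lemma exists_commutative_model (hη : η ≠ 0) (h : InhomCond η ξ)
    (h2 : ∀ a b, ξ a - ξ b - 2 * η ≠ 0) (K : Matrix (Fin 3) (Fin 3) ℂ) :
    ∃ (A : Type) (_ : CommRing A) (_ : Algebra ℂ A) (ι : A →ₐ[ℂ] Op N) (t₁ t₂ : ℂ → A),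
      Function.Injective ι ∧ (∀ lam, ι (t₁ lam) = T1 η ξ K lam) ∧
        ∀ lam, ι (t₂ lam) = T2 η ξ K lam := by
  set S : Set (Op N) := Set.range fun b => T1 η ξ K (ξ b) with hS
  have hcomm : ∀ a ∈ S, ∀ b ∈ S, a * b = b * a := by
    rintro _ ⟨a, rfl⟩ _ ⟨b, rfl⟩
    rcases eq_or_ne a b with rfl | hab
    · rfl
    obtain ⟨-, h1, h2⟩ := h a b hab
    refine (T1_commute η ξ K fun e => ?_).eq
    rcases sq_eq_sq_iff_eq_or_eq_neg.1 e with e | e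
    exacts [h1 e, h2 e]
  have e0 : shiftOn η ξ ∅ = ξ := by funext b; simp [shiftOn]
  have m0 : ∀ b, T1 η ξ K (ξ b) ∈ Algebra.adjoin ℂ S :=
    fun b => Algebra.subset_adjoin (Set.mem_range_self b)
  have m1 : ∀ lam, T1 η ξ K lam ∈ Algebra.adjoin ℂ S := by
    intro lam
    rw [T1_interpolate h K ∅ lam, e0]
    exact add_mem (Subalgebra.smul_mem _ (one_mem _) _)
      (sum_mem fun b _ => Subalgebra.smul_mem _ (m0 b) _)
  have m2 : ∀ lam, T2 η ξ K lam ∈ Algebra.adjoin ℂ S := by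
    intro lam
    obtain ⟨β, hβ⟩ := T2_interpolate hη h h2 K
    rw [hβ ∅ lam, e0]
    refine add_mem (Subalgebra.smul_mem _ (one_mem _) _)
      (sum_mem fun b _ => Subalgebra.smul_mem _ ?_ _)
    rw [← T1_mul_T1 η ξ K hη]
    exact mul_mem (m1 _) (m1 _)
  have := Algebra.isMulCommutative_adjoin ℂ hcomm
  exact ⟨Algebra.adjoin ℂ S, inferInstance, inferInstance, (Algebra.adjoin ℂ S).val,
    fun lam => ⟨_, m1 lam⟩, fun lam => ⟨_, m2 lam⟩, Subtype.val_injective,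
    fun _ => rfl, fun _ => rfl⟩

end CommutativeModel
end
end SoV

namespace SoV
noncomputable section

section AbstractOrthogonality

variable {ι A : Type*} [Fintype ι] [CommRing A] [Algebra ℂ A]

lemma map_mul_expand (φ : A →ₗ[ℂ] ℂ) (P v : A) {c : ℂ} {r : ι → ℂ} {f : ι → A}
    (hv : v = c • 1 + ∑ b, r b • f b) :
    φ (P * v) = c * φ P + ∑ b, r b * φ (P * f b) := by
  rw [hv, mul_add, Finset.mul_sum, map_add, map_sum]
  simp

lemma map_mul_eq_zero (φ : A →ₗ[ℂ] ℂ) (P v : A) {c : ℂ} {r : ι → ℂ} {f : ι → A}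
    (hv : v = c • 1 + ∑ b, r b • f b) (hP : φ P = 0) (hf : ∀ b, φ (P * f b) = 0) :
    φ (P * v) = 0 := by
  rw [map_mul_expand φ P v hv]
  simp [hP, hf]

lemma map_mul_eq_single (φ : A →ₗ[ℂ] ℂ) (P v : A) {c : ℂ} {r : ι → ℂ} {f : ι → A}
    (hv : v = c • 1 + ∑ b, r b • f b) (hP : φ P = 0) (a : ι)
    (hf : ∀ b, b ≠ a → φ (P * f b) = 0) : φ (P * v) = r a * φ (P * f a) := by
  rw [map_mul_expand φ P v hv, hP, mul_zero, zero_add]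
  exact Finset.sum_eq_single a (fun b _ hb => by rw [hf b hb, mul_zero]) (by simp)

variable [DecidableEq ι]

/-- Commuting elements with the fusion relations, the interpolation formulae and the reference
functional satisfied by the transfer matrices. -/
structure FusionModel (φ : A →ₗ[ℂ] ℂ) (x y w u : ι → A) (α β : Finset ι → ι → ℂ)
    (g k : Finset ι → ι → ι → ℂ) (ρ : ι → ℂ) (F : Finset ι → ℂ) : Prop where
  x_mul_y : ∀ a, x a * y a = 0
  x_mul_u : ∀ a, x a * u a = w a
  x_eq : ∀ Z a, x a = α Z a • 1 + ∑ b, g Z a b • (if b ∈ Z then u b else x b)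
  w_eq : ∀ Z a, w a = β Z a • 1 + ∑ b, k Z a b • (if b ∈ Z then y b else w b)
  k_self : ∀ Z, ∀ a ∈ Z, k Z a a = ρ a * g Z a a
  functional : ∀ X Y, Disjoint X Y →
    φ ((∏ a ∈ X, x a) * ∏ a ∈ Y, y a) = if X = ∅ ∧ Y = Finset.univ then 1 else 0
  F_empty : F ∅ = 1
  F_erase : ∀ Z, ∀ a ∈ Z, F Z = g Z a a * F (Z.erase a)

namespace FusionModel

variable {φ : A →ₗ[ℂ] ℂ} {x y w u : ι → A} {α β : Finset ι → ι → ℂ}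
  {g k : Finset ι → ι → ι → ℂ} {ρ : ι → ℂ} {F : Finset ι → ℂ}

lemma w_mul_y (D : FusionModel φ x y w u α β g k ρ F) (a : ι) : w a * y a = 0 := by
  rw [← D.x_mul_u, mul_right_comm, D.x_mul_y, zero_mul]

lemma w_mul_prod_y (D : FusionModel φ x y w u α β g k ρ F)
    {a : ι} {Y : Finset ι} (h : a ∈ Y) : w a * ∏ b ∈ Y, y b = 0 := by
  rw [← Finset.mul_prod_erase _ _ h, ← mul_assoc, D.w_mul_y, zero_mul]

lemma map_eq_zero_of_nonempty (D : FusionModel φ x y w u α β g k ρ F)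
    {X : Finset ι} (hX : X.Nonempty) (s : Multiset ι) (Y : Finset ι) :
    φ ((∏ a ∈ X, x a) * (∏ a ∈ Y, y a) * (s.map w).prod) = 0 := by
  induction s using Multiset.induction_on generalizing Y with
  | empty =>
    rw [Multiset.map_zero, Multiset.prod_zero, mul_one]
    by_cases h : Disjoint X Y
    · rw [D.functional X Y h, if_neg fun h => hX.ne_empty h.1]
    · obtain ⟨a, ha, hb⟩ := Finset.not_disjoint_iff.1 h
      rw [← Finset.mul_prod_erase _ _ ha, ← Finset.mul_prod_erase _ _ hb, mul_mul_mul_comm,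
        D.x_mul_y, zero_mul, map_zero]
  | cons a s ih =>
    rw [Multiset.map_cons, Multiset.prod_cons, mul_left_comm, mul_comm (w a)]
    refine map_mul_eq_zero φ _ _ (D.w_eq Yᶜ a) (ih Y) fun b => ?_
    split_ifs with hb
    · rw [← ih (insert b Y), Finset.prod_insert (Finset.mem_compl.1 hb)]
      congr 1; ring
    · have := D.w_mul_prod_y (not_not.1 fun h => hb (Finset.mem_compl.2 h))
      rw [← map_zero φ]
      congr 1
      linear_combination (∏ a ∈ X, x a) * (s.map w).prod * this

lemma map_sq_eq_zero (D : FusionModel φ x y w u α β g k ρ F)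
    {X Z : Finset ι} (hX : X.Nonempty) (hXZ : Disjoint X Z) (Y : Finset ι)
    (s : Multiset ι) :
    φ ((∏ a ∈ X, x a) * (∏ a ∈ Z, x a) ^ 2 * (∏ a ∈ Y, y a) * (s.map w).prod) = 0 := by
  induction hn : Z.card using Nat.strong_induction_on generalizing X Z s with
  | _ n ih =>
  subst hn
  rcases Z.eq_empty_or_nonempty with rfl | ⟨a, ha⟩
  · simpa using D.map_eq_zero_of_nonempty hX s Y
  have haX : a ∉ X := fun h => Finset.disjoint_left.1 hXZ h ha
  have hlt := Finset.card_erase_lt_of_mem ha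
  have hd : Disjoint (insert a X) (Z.erase a) := by
    rw [Finset.disjoint_insert_left]
    exact ⟨Finset.notMem_erase a Z, hXZ.mono_right (Finset.erase_subset a Z)⟩
  have e : (∏ a ∈ X, x a) * (∏ a ∈ Z, x a) ^ 2 * (∏ a ∈ Y, y a) * (s.map w).prod
      = (∏ b ∈ insert a X, x b) * (∏ b ∈ Z.erase a, x b) ^ 2 * (∏ a ∈ Y, y a) * (s.map w).prod
        * x a := by
    rw [← Finset.mul_prod_erase _ _ ha, Finset.prod_insert haX]; ring
  rw [e]
  refine map_mul_eq_zero φ _ _ (D.x_eq (X ∪ Z) a)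
    (ih _ hlt (Finset.insert_nonempty a X) hd s rfl) fun b => ?_
  by_cases hb : b ∈ insert a X
  · have hb' : b ∈ X ∪ Z := by
      rcases Finset.mem_insert.1 hb with rfl | h
      exacts [Finset.mem_union_right _ ha, Finset.mem_union_left _ h]
    rw [if_pos hb']
    have hne : ((insert a X).erase b).Nonempty := by
      rcases eq_or_ne b a with rfl | hba
      · rwa [Finset.erase_insert haX]
      · exact ⟨a, Finset.mem_erase.2 ⟨hba.symm, Finset.mem_insert_self a X⟩⟩
    rw [← ih _ hlt hne (hd.mono_left (Finset.erase_subset b _)) (b ::ₘ s) rfl,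
      ← Finset.mul_prod_erase _ _ hb, Multiset.map_cons, Multiset.prod_cons, ← D.x_mul_u b]
    congr 1; ring
  by_cases hbZ : b ∈ Z.erase a
  · rw [if_pos (Finset.mem_union_right _ (Finset.mem_of_mem_erase hbZ))]
    rw [← ih _ ((Finset.card_erase_lt_of_mem hbZ).trans hlt) (Finset.insert_nonempty b _)
      (Z := (Z.erase a).erase b) ?_ (b ::ₘ s) rfl, Finset.prod_insert hb,
      ← Finset.mul_prod_erase _ _ hbZ, Multiset.map_cons, Multiset.prod_cons, ← D.x_mul_u b]
    · congr 1; ring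
    · rw [Finset.disjoint_insert_left]
      exact ⟨Finset.notMem_erase b _, hd.mono_right (Finset.erase_subset b _)⟩
  · have hb' : b ∉ X ∪ Z := by
      simp only [Finset.mem_insert, Finset.mem_erase, not_or, not_and] at hb hbZ
      rw [Finset.mem_union, not_or]
      exact ⟨hb.2, hbZ hb.1⟩
    rw [if_neg hb', ← ih _ hlt (Finset.insert_nonempty b _)
      (Finset.disjoint_insert_left.2 ⟨hbZ, hd⟩) s rfl, Finset.prod_insert hb]
    congr 1; ring

lemma map_sq (D : FusionModel φ x y w u α β g k ρ F) (Z Y : Finset ι) (s : Multiset ι) :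
    φ ((∏ a ∈ Z, x a) ^ 2 * (∏ a ∈ Y, y a) * (s.map w).prod)
      = F Z * φ ((∏ a ∈ Y, y a) * ((Z.val + s).map w).prod) := by
  induction Z using Finset.induction_on generalizing s with
  | empty => simp [D.F_empty]
  | insert a Z ha ih =>
    have e : (∏ b ∈ insert a Z, x b) ^ 2 * (∏ a ∈ Y, y a) * (s.map w).prod
        = (∏ b ∈ {a}, x b) * (∏ b ∈ Z, x b) ^ 2 * (∏ a ∈ Y, y a) * (s.map w).prod * x a := by
      rw [Finset.prod_insert ha, Finset.prod_singleton]; ring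
    have hd : Disjoint {a} Z := Finset.disjoint_singleton_left.2 ha
    rw [e, map_mul_eq_single φ _ _ (D.x_eq (insert a Z) a)
      (D.map_sq_eq_zero (Finset.singleton_nonempty a) hd Y s) a,
      if_pos (Finset.mem_insert_self a Z), D.F_erase _ a (Finset.mem_insert_self a Z),
      Finset.erase_insert ha, mul_assoc (g _ _ _) (F Z)]
    · rw [Finset.insert_val_of_notMem ha, Multiset.cons_add, ← Multiset.add_cons, ← ih,
        Multiset.map_cons, Multiset.prod_cons, Finset.prod_singleton, ← D.x_mul_u a]
      congr 2; ring
    · intro b hb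
      have hb1 : b ∉ ({a} : Finset ι) := Finset.notMem_singleton.2 hb
      by_cases hbZ : b ∈ Z
      · rw [if_pos (Finset.mem_insert_of_mem hbZ), ← D.map_sq_eq_zero (Z := Z.erase b)
          (Finset.insert_nonempty b {a}) ?_ Y (b ::ₘ s), Finset.prod_insert hb1,
          ← Finset.mul_prod_erase _ _ hbZ, Multiset.map_cons, Multiset.prod_cons, ← D.x_mul_u b]
        · congr 1; ring
        · rw [Finset.disjoint_insert_left]
          exact ⟨Finset.notMem_erase b _, hd.mono_right (Finset.erase_subset b _)⟩
      · rw [if_neg fun h => (Finset.mem_insert.1 h).elim hb hbZ, ← D.map_sq_eq_zero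
          (Finset.insert_nonempty b {a}) (Finset.disjoint_insert_left.2 ⟨hbZ, hd⟩) Y s,
          Finset.prod_insert hb1]
        congr 1; ring

lemma map_eq_zero_of_card_lt (D : FusionModel φ x y w u α β g k ρ F) (Y : Finset ι) (s : Multiset ι)
    (h : s.card + Y.card < Fintype.card ι) : φ ((∏ a ∈ Y, y a) * (s.map w).prod) = 0 := by
  induction s using Multiset.induction_on generalizing Y with
  | empty =>
    have := D.functional ∅ Y (Finset.disjoint_empty_left Y)
    rw [Finset.prod_empty, one_mul, if_neg] at this
    · simpa using this
    · rintro ⟨-, rfl⟩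
      simp at h
  | cons a s ih =>
    rw [Multiset.card_cons] at h
    rw [Multiset.map_cons, Multiset.prod_cons, mul_left_comm, mul_comm (w a)]
    refine map_mul_eq_zero φ _ _ (D.w_eq Yᶜ a) (ih Y (by omega)) fun b => ?_
    split_ifs with hb
    · have hb := Finset.mem_compl.1 hb
      rw [← ih (insert b Y) (by rw [Finset.card_insert_of_notMem hb]; omega),
        Finset.prod_insert hb]
      congr 1; ring
    · have := D.w_mul_prod_y (not_not.1 fun h => hb (Finset.mem_compl.2 h))
      rw [← map_zero φ]
      congr 1
      linear_combination (s.map w).prod * this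

lemma map_compl (D : FusionModel φ x y w u α β g k ρ F) (Z : Finset ι) :
    φ ((∏ a ∈ Zᶜ, y a) * (Z.val.map w).prod) = F Z * ∏ a ∈ Z, ρ a := by
  induction Z using Finset.induction_on with
  | empty =>
    have := D.functional ∅ Finset.univ (Finset.disjoint_empty_left _)
    simpa [D.F_empty] using this
  | insert a Z ha ih =>
    rw [Finset.insert_val_of_notMem ha, Multiset.map_cons, Multiset.prod_cons, mul_left_comm,
      mul_comm (w a), map_mul_eq_single φ _ _ (D.w_eq (insert a Z) a) _ a,
      if_pos (Finset.mem_insert_self a Z), D.F_erase _ a (Finset.mem_insert_self a Z),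
      D.k_self _ a (Finset.mem_insert_self a Z), Finset.erase_insert ha, Finset.prod_insert ha]
    · have e : (∏ b ∈ (insert a Z)ᶜ, y b) * (Z.val.map w).prod * y a
          = (∏ b ∈ Zᶜ, y b) * (Z.val.map w).prod := by
        rw [Finset.compl_insert, ← Finset.mul_prod_erase Zᶜ _ (Finset.mem_compl.2 ha)]; ring
      rw [e, ih]; ring
    · intro b hb
      rw [← map_zero φ]
      congr 1
      split_ifs with h
      · have hbZ := (Finset.mem_insert.1 h).resolve_left hb
        have := D.w_mul_y b
        change _ * (∏ a ∈ Z, w a) * _ = _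
        rw [← Finset.mul_prod_erase _ _ hbZ]
        linear_combination (∏ b ∈ (insert a Z)ᶜ, y b) * (∏ c ∈ Z.erase b, w c) * this
      · have := D.w_mul_prod_y (Finset.mem_compl.2 h)
        linear_combination (Z.val.map w).prod * this
    · apply D.map_eq_zero_of_card_lt
      have h1 := Finset.card_compl_add_card (insert a Z)
      rw [Finset.card_insert_of_notMem ha] at h1
      rw [Finset.card_val]; omega

/-- Orthogonality of the SoV co-vectors and vectors. -/
theorem map_mul (D : FusionModel φ x y w u α β g k ρ F) (h k' : ι → Fin 3) :
    φ ((∏ b, (if h b = 0 then y b else 1) * (if h b = 2 then x b else 1)) *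
        ∏ b, (if k' b = 1 then w b else 1) * (if k' b = 2 then x b else 1))
      = if h = k' then F {b | h b = 2} * (F {b | h b ≠ 0} * ∏ b, if h b = 0 then 1 else ρ b)
        else 0 := by
  set X : Finset ι := {b | ¬(h b = 2 ↔ k' b = 2)} with hX
  set Z : Finset ι := {b | h b = 2 ∧ k' b = 2} with hZ
  set Y : Finset ι := {b | h b = 0} with hY
  set B : Finset ι := {b | k' b = 1} with hB
  have e : (∏ b, (if h b = 0 then y b else 1) * (if h b = 2 then x b else 1)) *
        ∏ b, (if k' b = 1 then w b else 1) * (if k' b = 2 then x b else 1)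
      = (∏ a ∈ X, x a) * (∏ a ∈ Z, x a) ^ 2 * (∏ a ∈ Y, y a) * (B.val.map w).prod := by
    change _ = _ * ∏ a ∈ B, w a
    rw [hX, hZ, hY, hB]
    simp only [Finset.prod_filter, ← Finset.prod_mul_distrib, pow_two]
    refine Finset.prod_congr rfl fun b _ => ?_
    generalize h b = p
    generalize k' b = q
    fin_cases p <;> fin_cases q <;> simp <;> ring
  rw [e]
  by_cases hXe : X.Nonempty
  · rw [D.map_sq_eq_zero hXe, if_neg]
    · rintro rfl
      obtain ⟨b, hb⟩ := hXe
      simp [hX] at hb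
    · rw [Finset.disjoint_left]
      intro b hb hb'
      simp only [hX, hZ, Finset.mem_filter_univ] at hb hb'
      exact hb ⟨fun _ => hb'.2, fun _ => hb'.1⟩
  rw [Finset.not_nonempty_iff_eq_empty] at hXe
  have h2 : ∀ b, h b = 2 ↔ k' b = 2 := fun b => by
    by_contra hb
    exact Finset.notMem_empty b (hXe ▸ (Finset.mem_filter_univ b).2 hb)
  rw [hXe, Finset.prod_empty, one_mul, D.map_sq]
  have hZB : Disjoint Z B := by
    rw [Finset.disjoint_left]
    intro b hb hb'
    simp only [hZ, hB, Finset.mem_filter_univ] at hb hb'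
    rw [hb.2] at hb'
    exact absurd hb' (by decide)
  rw [← Finset.disjUnion_val _ _ hZB]
  by_cases hk : h = k'
  · subst hk
    have e1 : Z = ({b | h b = 2} : Finset ι) := by simp [hZ]
    have e2 : Z.disjUnion B hZB = ({b | h b ≠ 0} : Finset ι) := by
      ext b
      simp only [hZ, hB, Finset.mem_disjUnion, Finset.mem_filter_univ, and_self]
      generalize h b = p
      fin_cases p <;> simp
    have e3 : Y = ({b | h b ≠ 0} : Finset ι)ᶜ := by ext b; simp [hY]
    rw [e2, e3, D.map_compl, if_pos rfl, e1, Finset.prod_filter]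
    simp only [ite_not]
  · rw [if_neg hk]
    by_cases h01 : ∃ b, h b = 0 ∧ k' b = 1
    · obtain ⟨b, hb, hb'⟩ := h01
      have hbY : b ∈ Y := (Finset.mem_filter_univ b).2 hb
      have hbB : b ∈ Z.disjUnion B hZB :=
        Finset.mem_disjUnion.2 (Or.inr ((Finset.mem_filter_univ b).2 hb'))
      have : (∏ a ∈ Y, y a) * ∏ a ∈ Z.disjUnion B hZB, w a = 0 := by
        rw [← Finset.mul_prod_erase _ _ hbB]
        linear_combination (∏ c ∈ (Z.disjUnion B hZB).erase b, w c) * D.w_mul_prod_y hbY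
      exact mul_eq_zero_of_right _ ((congrArg φ this).trans (map_zero φ))
    · rw [D.map_eq_zero_of_card_lt, mul_zero]
      obtain ⟨b, hb⟩ := Function.ne_iff.1 hk
      have hd : Disjoint (Z.disjUnion B hZB) Y := by
        rw [Finset.disjoint_left]
        intro c hc hc'
        simp only [hZ, hB, hY, Finset.mem_disjUnion, Finset.mem_filter_univ] at hc hc'
        rcases hc with hc | hc
        · rw [hc.1] at hc'; exact absurd hc' (by decide)
        · exact h01 ⟨c, hc', hc⟩
      rw [Finset.card_val, ← Finset.card_union_of_disjoint hd]
      refine Finset.card_lt_univ_of_notMem (x := b) ?_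
      simp only [Finset.mem_union, hZ, hB, hY, Finset.mem_disjUnion, Finset.mem_filter_univ]
      have hb2 := h2 b
      have hb3 : ¬(h b = 0 ∧ k' b = 1) := fun h => h01 ⟨b, h⟩
      revert hb hb2 hb3
      generalize h b = p
      generalize k' b = q
      revert p q
      decide

end FusionModel

end AbstractOrthogonality
end
end SoV

namespace SoV
noncomputable section
variable {N : ℕ} {η : ℂ} {ξ : Fin N → ℂ}

lemma Vdm_eq_mul_prod_erase {M : ℕ} (x : Fin M → ℂ) (a : Fin M) :
    Vdm x = (∏ j ∈ Finset.univ.erase a, ((if j < a then 1 else -1) *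
      ∏ i ∈ Finset.univ.erase a, if i < j then x j - x i else 1)) *
        ∏ i ∈ Finset.univ.erase a, (x a - x i) := by
  have e : ∀ j, ∏ i ∈ Finset.univ.filter (fun i => i < j), (x j - x i)
      = (if a < j then x j - x a else 1) *
        ∏ i ∈ Finset.univ.erase a, if i < j then x j - x i else 1 := fun j => by
    rw [Finset.prod_filter, ← Finset.mul_prod_erase _ _ (Finset.mem_univ a)]
  rw [Vdm, ← Finset.mul_prod_erase _ _ (Finset.mem_univ a), e a, if_neg (lt_irrefl a), one_mul,
    ← Finset.prod_mul_distrib, ← Finset.prod_mul_distrib]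
  refine Finset.prod_congr rfl fun j hj => ?_
  rw [e j]
  rcases lt_or_gt_of_ne (Finset.ne_of_mem_erase hj) with h | h
  · rw [if_pos h, if_neg h.not_gt, if_pos h]; ring
  · rw [if_neg h.not_gt, if_pos h, if_neg h.not_gt]; ring

lemma Vdm_update_mul {M : ℕ} (x : Fin M → ℂ) (a : Fin M) (v : ℂ) :
    Vdm (Function.update x a v) * ∏ c ∈ Finset.univ.erase a, (x a - x c)
      = Vdm x * ∏ c ∈ Finset.univ.erase a, (v - x c) := by
  rw [Vdm_eq_mul_prod_erase x a, Vdm_eq_mul_prod_erase (Function.update x a v) a,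
    Function.update_self]
  have e : ∀ c ∈ Finset.univ.erase a, Function.update x a v c = x c := fun c hc =>
    Function.update_of_ne (Finset.ne_of_mem_erase hc) _ _
  have e1 : ∏ i ∈ Finset.univ.erase a, (v - Function.update x a v i)
      = ∏ i ∈ Finset.univ.erase a, (v - x i) :=
    Finset.prod_congr rfl fun i hi => by rw [e i hi]
  have e2 : (∏ j ∈ Finset.univ.erase a, ((if j < a then (1 : ℂ) else -1) *
      ∏ i ∈ Finset.univ.erase a,
        if i < j then Function.update x a v j - Function.update x a v i else 1))
      = ∏ j ∈ Finset.univ.erase a, ((if j < a then (1 : ℂ) else -1) *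
        ∏ i ∈ Finset.univ.erase a, if i < j then x j - x i else 1) := by
    refine Finset.prod_congr rfl fun j hj => ?_
    congr 1
    exact Finset.prod_congr rfl fun i hi => by rw [e i hi, e j hj]
  rw [e1, e2]
  ring

lemma Vdm_ne_zero {M : ℕ} {x : Fin M → ℂ} (hx : Function.Injective x) : Vdm x ≠ 0 := by
  refine Finset.prod_ne_zero_iff.2 fun j _ => Finset.prod_ne_zero_iff.2 fun i hi => ?_
  exact sub_ne_zero.2 fun h => (Finset.mem_filter.1 hi).2.ne' (hx h)

lemma Vdm_div_shiftOn (h : InhomCond η ξ) (Z : Finset (Fin N)) (a : Fin N) (ha : a ∈ Z) :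
    Vdm ξ / Vdm (shiftOn η ξ Z)
      = lagr (shiftOn η ξ Z) (ξ a) a * (Vdm ξ / Vdm (shiftOn η ξ (Z.erase a))) := by
  have e : shiftOn η ξ (Z.erase a) = Function.update (shiftOn η ξ Z) a (ξ a) := by
    ext b
    rcases eq_or_ne b a with rfl | hb
    · simp [shiftOn]
    · simp [shiftOn, hb]
  have h1 := Vdm_ne_zero (h.shiftOn_injective Z)
  have h2 := Vdm_ne_zero (h.shiftOn_injective (Z.erase a))
  have h3 := Vdm_update_mul (shiftOn η ξ Z) a (ξ a)
  have h4 : ∏ c ∈ Finset.univ.erase a, (shiftOn η ξ Z a - shiftOn η ξ Z c) ≠ 0 :=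
    Finset.prod_ne_zero_iff.2 fun c hc => sub_ne_zero.2 fun h' =>
      Finset.ne_of_mem_erase hc (h.shiftOn_injective Z h').symm
  rw [e] at h2 ⊢
  rw [lagr, Finset.prod_div_distrib]
  field_simp
  linear_combination Vdm ξ * h3

lemma dfun_sub_ne_zero (hη : η ≠ 0) (h : InhomCond η ξ) (a : Fin N) : dfun ξ (ξ a - η) ≠ 0 := by
  refine Finset.prod_ne_zero_iff.2 fun b _ => ?_
  rcases eq_or_ne a b with rfl | hab
  · simpa using hη
  · exact fun h' => (h a b hab).2.1 (by linear_combination h')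

lemma Nh_eq (hη : η ≠ 0) (h : InhomCond η ξ) (l : St N) :
    (Vdm ξ / Vdm (shiftOn η ξ {b | l b = 2})) * ((Vdm ξ / Vdm (shiftOn η ξ {b | l b ≠ 0})) *
      ∏ b, if l b = 0 then 1 else dfun ξ (ξ b - η) / dfun ξ (ξ b - 2 * η)) = Nh η ξ l := by
  have e1 : (fun a => ξ a - (if l a = 0 then 0 else 1 : ℂ) * η)
      = shiftOn η ξ {b | l b ≠ 0} := by
    ext b; simp [shiftOn, ite_not]
  have e2 : (fun a => ξ a - (if l a = 2 then 1 else 0 : ℂ) * η)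
      = shiftOn η ξ {b | l b = 2} := by
    ext b; simp [shiftOn]
  have e3 : ∀ a, dfun ξ (ξ a - η) / dfun ξ (ξ a - ((1 : ℂ) + (if l a = 0 then 0 else 1)) * η)
      = if l a = 0 then 1 else dfun ξ (ξ a - η) / dfun ξ (ξ a - 2 * η) := fun a => by
    split_ifs
    · rw [add_zero, one_mul, div_self (dfun_sub_ne_zero hη h a)]
    · norm_num
  rw [Nh, e1, e2, Finset.prod_congr rfl fun a _ => e3 a]
  have h1 := Vdm_ne_zero (h.shiftOn_injective {b | l b = 2})
  have h2 := Vdm_ne_zero (h.shiftOn_injective {b | l b ≠ 0})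
  field_simp

lemma Nh_ne_zero (hη : η ≠ 0) (h : InhomCond η ξ) (h2 : ∀ a b, ξ a - ξ b - 2 * η ≠ 0) (l : St N) :
    Nh η ξ l ≠ 0 := by
  have h0 : Function.Injective ξ := fun a b hab => by
    by_contra hne
    exact (h a b hne).1 (sub_eq_zero.2 hab)
  rw [← Nh_eq hη h]
  refine mul_ne_zero (div_ne_zero (Vdm_ne_zero h0) (Vdm_ne_zero (h.shiftOn_injective _)))
    (mul_ne_zero (div_ne_zero (Vdm_ne_zero h0) (Vdm_ne_zero (h.shiftOn_injective _)))
      (Finset.prod_ne_zero_iff.2 fun b _ => ?_))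
  split_ifs
  · exact one_ne_zero
  · refine div_ne_zero (dfun_sub_ne_zero hη h b) (Finset.prod_ne_zero_iff.2 fun c _ => ?_)
    have := h2 b c
    rwa [sub_right_comm] at this

lemma pair_eq_dotProduct (L v : Hsp N) : pair L v = L ⬝ᵥ v := rfl

/-- The functional `X ↦ ⟨L|ι(X)|R⟩`. -/
def matrixElement {A : Type*} [CommRing A] [Algebra ℂ A] (ι : A →ₐ[ℂ] Op N) (L R : Hsp N) :
    A →ₗ[ℂ] ℂ where
  toFun a := L ⬝ᵥ (ι a).mulVec R
  map_add' a b := by rw [map_add, Matrix.add_mulVec, dotProduct_add]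
  map_smul' c a := by rw [map_smul, Matrix.smul_mulVec, dotProduct_smul]; rfl

section Model

variable {K : Matrix (Fin 3) (Fin 3) ℂ} {A : Type*} [CommRing A] [Algebra ℂ A]
  {ι : A →ₐ[ℂ] Op N} {t₁ t₂ : ℂ → A}

lemma sovCovOp_eq_map (ht₁ : ∀ lam, ι (t₁ lam) = T1 η ξ K lam)
    (ht₂ : ∀ lam, ι (t₂ lam) = T2 η ξ K lam) (h : St N) :
    sovCovOp η ξ K h = ι (∏ b, (if h b = 0 then t₂ (ξ b - η) else 1) *
      (if h b = 2 then t₁ (ξ b) else 1)) := by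
  rw [sovCovOp, ← List.prod_ofFn, map_list_prod, List.map_ofFn]
  congr 2
  ext1 b
  simp only [Function.comp_apply, map_mul, apply_ite ι, ht₁, ht₂, map_one, pow_ite, pow_one,
    pow_zero]

lemma sovVecOp_eq_map (ht₁ : ∀ lam, ι (t₁ lam) = T1 η ξ K lam)
    (ht₂ : ∀ lam, ι (t₂ lam) = T2 η ξ K lam) (h : St N) :
    sovVecOp η ξ K h = ι (∏ b, (if h b = 1 then t₂ (ξ b) else 1) *
      (if h b = 2 then t₁ (ξ b) else 1)) := by
  rw [sovVecOp, ← List.prod_ofFn, map_list_prod, List.map_ofFn]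
  congr 2
  ext1 b
  simp only [Function.comp_apply, map_mul, apply_ite ι, ht₁, ht₂, map_one, pow_ite, pow_one,
    pow_zero]

lemma pair_sovCov (ht₁ : ∀ lam, ι (t₁ lam) = T1 η ξ K lam)
    (ht₂ : ∀ lam, ι (t₂ lam) = T2 η ξ K lam) (L R : Hsp N) (h : St N) :
    pair (sovCov η ξ K L h) R = matrixElement ι L R
      (∏ b, (if h b = 0 then t₂ (ξ b - η) else 1) * (if h b = 2 then t₁ (ξ b) else 1)) := by
  rw [sovCov, sovCovOp_eq_map ht₁ ht₂, pair_eq_dotProduct, ← Matrix.dotProduct_mulVec]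
  rfl

lemma pair_sovCov_sovVec (ht₁ : ∀ lam, ι (t₁ lam) = T1 η ξ K lam)
    (ht₂ : ∀ lam, ι (t₂ lam) = T2 η ξ K lam) (L R : Hsp N) (h k : St N) :
    pair (sovCov η ξ K L h) (sovVec η ξ K R k) = matrixElement ι L R
      ((∏ b, (if h b = 0 then t₂ (ξ b - η) else 1) * (if h b = 2 then t₁ (ξ b) else 1)) *
        ∏ b, (if k b = 1 then t₂ (ξ b) else 1) * (if k b = 2 then t₁ (ξ b) else 1)) := by
  rw [pair_sovCov ht₁ ht₂, sovVec, sovVecOp_eq_map ht₁ ht₂]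
  change _ ⬝ᵥ _ = _ ⬝ᵥ _
  rw [Matrix.mulVec_mulVec, map_mul]

end Model

theorem pair_sovCov_sovVec_eq (hη : η ≠ 0) (h : InhomCond η ξ)
    (h2 : ∀ a b, ξ a - ξ b - 2 * η ≠ 0) {K : Matrix (Fin 3) (Fin 3) ℂ} (hK : K.det = 0)
    {L R : Hsp N} (hR : DualRef η ξ K L R) (l k : St N) :
    pair (sovCov η ξ K L l) (sovVec η ξ K R k) = if l = k then Nh η ξ l else 0 := by
  obtain ⟨A, _, _, ι, t₁, t₂, hι, ht₁, ht₂⟩ := exists_commutative_model hη h h2 K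
  obtain ⟨β, hβ⟩ := T2_interpolate hη h h2 K
  have D : FusionModel (matrixElement ι L R) (fun a => t₁ (ξ a)) (fun a => t₂ (ξ a - η))
      (fun a => t₂ (ξ a)) (fun a => t₁ (ξ a - η))
      (fun Z a => (∏ b, (ξ a - shiftOn η ξ Z b)) * K.trace) (fun Z a => β Z (ξ a))
      (fun Z a b => lagr (shiftOn η ξ Z) (ξ a) b)
      (fun Z a b => (∏ c, (ξ a - (ξ c + η)) / (shiftOn η ξ Z b - (ξ c + η))) *
        lagr (shiftOn η ξ Z) (ξ a) b)
      (fun b => dfun ξ (ξ b - η) / dfun ξ (ξ b - 2 * η))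
      (fun Z => Vdm ξ / Vdm (shiftOn η ξ Z)) := by
    constructor
    · intro a
      apply hι
      rw [map_mul, ht₁, ht₂, T1_mul_T2 η ξ K hη hK, map_zero]
    · intro a
      apply hι
      rw [map_mul, ht₁, ht₁, ht₂, T1_mul_T1 η ξ K hη]
    · intro Z a
      apply hι
      rw [ht₁, T1_interpolate h K Z]
      simp only [map_add, map_smul, map_one, map_sum, apply_ite ι, ht₁]
      congr 1
      refine Finset.sum_congr rfl fun b _ => ?_
      rw [shiftOn]
      split_ifs <;> simp
    · intro Z a
      apply hι
      rw [ht₂, hβ Z]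
      simp only [map_add, map_smul, map_one, map_sum, apply_ite ι, ht₂]
      congr 1
      refine Finset.sum_congr rfl fun b _ => ?_
      congr 1
      rw [shiftOn]
      split_ifs <;> simp
    · intro Z a ha
      congr 1
      rw [dfun, dfun, ← Finset.prod_div_distrib]
      refine Finset.prod_congr rfl fun c _ => ?_
      rw [shiftOn, if_pos ha]
      congr 1 <;> ring
    · intro X Y hXY
      set l : St N := fun b => if b ∈ Y then 0 else if b ∈ X then 2 else 1 with hl
      have h0 : ∀ b, l b = 0 ↔ b ∈ Y := fun b => by
        simp only [hl]; split_ifs <;> simp_all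
      have h2 : ∀ b, l b = 2 ↔ b ∈ X := fun b => by
        have := fun hb : b ∈ X => Finset.disjoint_left.1 hXY hb
        simp only [hl]; split_ifs <;> simp_all
      have := hR l
      rw [pair_sovCov ht₁ ht₂] at this
      simp only [h0, h2] at this
      rw [Finset.prod_mul_distrib, Finset.prod_ite_mem, Finset.prod_ite_mem, Finset.univ_inter,
        Finset.univ_inter, mul_comm] at this
      rw [this]
      refine if_congr ?_ rfl rfl
      constructor
      · intro hz
        have hz' : ∀ b, l b = 0 := fun b => congrFun hz b
        refine ⟨Finset.eq_empty_of_forall_notMem fun b hb => ?_,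
          Finset.eq_univ_of_forall fun b => (h0 b).1 (hz' b)⟩
        have := (h2 b).2 hb
        rw [hz' b] at this
        exact absurd this (by decide)
      · rintro ⟨-, rfl⟩
        ext1 b
        exact (h0 b).2 (Finset.mem_univ b)
    · have : shiftOn η ξ ∅ = ξ := by ext b; simp [shiftOn]
      rw [this, div_self]
      have := h.shiftOn_injective ∅
      exact Vdm_ne_zero (by simpa [‹shiftOn η ξ ∅ = ξ›] using this)
    · exact fun Z a ha => Vdm_div_shiftOn h Z a ha
  rw [pair_sovCov_sovVec ht₁ ht₂, D.map_mul, Nh_eq hη h]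

end
end SoV

namespace SoV
noncomputable section
variable {N : ℕ} {η : ℂ} {ξ : Fin N → ℂ}

lemma isBasisFamily_of_det_ne_zero {v : St N → Hsp N} (h : (Matrix.of v : Op N).det ≠ 0) :
    IsBasisFamily v := by
  have hli : LinearIndependent ℂ v := Matrix.linearIndependent_rows_iff_isUnit.2
    ((Matrix.isUnit_iff_isUnit_det _).2 (isUnit_iff_ne_zero.2 h))
  exact ⟨hli, hli.span_eq_top_of_card_eq_finrank' (by simp)⟩

/-- The conclusions of the theorem for fixed inhomogeneities and reference co-vector. -/
theorem sov_of_det_ne_zero (hη : η ≠ 0) (h : InhomCond η ξ)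
    (h2 : ∀ a b, ξ a - ξ b - 2 * η ≠ 0) {K : Matrix (Fin 3) (Fin 3) ℂ} (hK : K.det = 0)
    {L : Hsp N} (hL : (Matrix.of (sovCov η ξ K L) : Op N).det ≠ 0) :
    IsBasisFamily (sovCov η ξ K L) ∧
      ∀ R0 : Hsp N, DualRef η ξ K L R0 →
        IsBasisFamily (sovVec η ξ K R0) ∧
        (∀ h k : St N, pair (sovCov η ξ K L h) (sovVec η ξ K R0 k) =
          if h = k then Nh η ξ h else 0) ∧
        (1 : Op N) = ∑ h : St N,
          (Nh η ξ h)⁻¹ • Matrix.vecMulVec (sovVec η ξ K R0 h) (sovCov η ξ K L h) := by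
  refine ⟨isBasisFamily_of_det_ne_zero hL, fun R0 hR => ?_⟩
  have horth := pair_sovCov_sovVec_eq hη h h2 hK hR
  have hN := Nh_ne_zero hη h h2
  set C : Op N := Matrix.of (sovCov η ξ K L) with hC
  set V : Op N := Matrix.of (sovVec η ξ K R0) with hV
  have hCV : C * V.transpose = Matrix.diagonal (Nh η ξ) := by
    ext l k
    rw [Matrix.diagonal_apply, ← horth l k]
    rfl
  have hone : (Matrix.diagonal (fun l => (Nh η ξ l)⁻¹) * C) * V.transpose = 1 := by
    rw [Matrix.mul_assoc, hCV, Matrix.diagonal_mul_diagonal, ← Matrix.diagonal_one]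
    congr 1
    ext l
    exact inv_mul_cancel₀ (hN l)
  refine ⟨isBasisFamily_of_det_ne_zero ?_, horth, ?_⟩
  · have := congrArg Matrix.det hone
    rw [Matrix.det_mul, Matrix.det_transpose, Matrix.det_one] at this
    exact right_ne_zero_of_mul (this ▸ one_ne_zero)
  · rw [← mul_eq_one_comm.1 hone]
    ext f g
    rw [Matrix.mul_apply, Matrix.sum_apply]
    refine Finset.sum_congr rfl fun l _ => ?_
    rw [Matrix.diagonal_mul, Matrix.smul_apply, Matrix.vecMulVec_apply, smul_eq_mul]
    simp only [hC, hV, Matrix.transpose_apply, Matrix.of_apply]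
    ring

end
end SoV

namespace SoV
noncomputable section
variable {N : ℕ} {η : ℂ} {K : Matrix (Fin 3) (Fin 3) ℂ}

lemma MPL.Raux_const {ξ : ℂ → Fin N → ℂ} {lam : ℂ → ℂ} {n : Fin N} {c : ℂ}
    (h : ∀ t, lam t - ξ t n = c) :
    MPL (fun t => SoV.Raux η (ξ t) (lam t) n) 0 (SoV.Raux η 0 c n) := by
  have e : (fun t => SoV.Raux η (ξ t) (lam t) n) = fun _ => SoV.Raux η 0 c n := by
    funext t
    simp only [SoV.Raux, h, Pi.zero_apply, sub_zero]
  rw [e]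
  exact MPL.const _

lemma list_prod_smul_ite {R σ : Type*} [Ring R] [Algebra ℂ R] [DecidableEq σ] (X : R) (c : σ → ℂ)
    (a : σ) {l : List σ} (h : l.Nodup) :
    (l.map fun n => c n • if n = a then X else 1).prod
      = (l.map c).prod • if a ∈ l then X else 1 := by
  induction l with
  | nil => simp
  | cons b l ih =>
    rw [List.nodup_cons] at h
    rw [List.map_cons, List.prod_cons, List.map_cons, List.prod_cons, ih h.2, smul_mul_smul_comm]
    congr 1
    rcases eq_or_ne b a with rfl | hb
    · simp [h.1]
    · simp [hb, hb.symm]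

lemma tens_eq_list_prod (A : Fin N → Matrix (Fin 3) (Fin 3) ℂ) :
    ((List.finRange N).map fun n => site n (A n)).prod = tens A := by
  have e : ∀ l : List (Fin N), l.Nodup → ∀ m,
      (l.map fun n => (Pi.mulSingle n (A n) : Fin N → Matrix (Fin 3) (Fin 3) ℂ)).prod m
        = if m ∈ l then A m else 1 := by
    intro l hl m
    induction l with
    | nil => simp
    | cons b l ih =>
      rw [List.nodup_cons] at hl
      rw [List.map_cons, List.prod_cons, Pi.mul_apply, ih hl.2]
      rcases eq_or_ne m b with rfl | hb
      · simp [hl.1]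
      · simp [hb]
  have : (fun n => site n (A n)) = fun n => tens (Pi.mulSingle n (A n)) := rfl
  rw [this, ← Function.comp_def tens, ← List.map_map, ← map_list_prod]
  congr 1
  funext m
  rw [e _ (List.nodup_finRange N), if_pos (List.mem_finRange m)]

/-- The spacing of the inhomogeneities in the asymptotic regime `ξₙ = n t`, with the convention
that the spacing of a site with itself is `1`. -/
def spacing (a n : Fin N) : ℂ := if n = a then 1 else (a : ℂ) - n

lemma spacing_ne_zero (a n : Fin N) : spacing a n ≠ 0 := by
  rw [spacing]
  split_ifs with h
  · exact one_ne_zero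
  · rw [sub_ne_zero, Ne, Nat.cast_inj, Fin.val_inj]
    exact fun h' => h h'.symm

lemma MPL.Raux_asymptotic (a n : Fin N) (c : ℂ) :
    MPL (fun t => SoV.Raux η (fun m : Fin N => (m : ℂ) * t) ((a : ℂ) * t + c) n)
      (if n = a then 0 else 1) (spacing a n • if n = a then SoV.Raux η 0 c a else 1) := by
  split_ifs with h
  · subst h
    rw [spacing, if_pos rfl, one_smul]
    exact MPL.Raux_const fun t => by ring
  · rw [spacing, if_neg h]
    exact MPL.Raux (b := c) fun t => by ring

/-- The product of the spacings between a site and the others. -/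
def totalSpacing (a : Fin N) : ℂ := ((sites N).map (spacing a)).prod

lemma totalSpacing_ne_zero (a : Fin N) : totalSpacing a ≠ 0 := by
  refine List.prod_ne_zero fun h => ?_
  obtain ⟨n, -, hn⟩ := List.mem_map.1 h
  exact spacing_ne_zero a n hn

lemma ent_asymptotic (a : Fin N) (c : ℂ) (i k : Fin 3) :
    ent (Kaux K * ((sites N).map fun n =>
      spacing a n • if n = a then Raux η 0 c a else 1).prod) i k
      = totalSpacing a • site a (∑ j, K i j • lax c η j k) := by
  rw [list_prod_smul_ite _ _ _ nodup_sites, if_pos (mem_sites a), ent_mul, mulE]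
  simp only [ent_Kaux, smul_mul_assoc, one_mul, map_sum, map_smul, Finset.smul_sum]
  refine Finset.sum_congr rfl fun j _ => ?_
  have e : ent (((sites N).map (spacing a)).prod • Raux η 0 c a) j k
      = totalSpacing a • ent (Raux η 0 c a) j k := rfl
  rw [e, ent_Raux, smul_comm, Pi.zero_apply, sub_zero]

lemma sum_smul_lax (η : ℂ) (K : Matrix (Fin 3) (Fin 3) ℂ) :
    ∑ i, ∑ j, K i j • lax 0 η j i = η • K := by
  ext p q
  simp only [lax, Matrix.sum_apply, Matrix.smul_apply, Matrix.add_apply, smul_eq_mul,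
    Matrix.single_apply, ite_and, mul_ite, mul_one, mul_zero]
  rw [Finset.sum_eq_single p, Finset.sum_eq_single q]
  · simp [mul_comm]
  all_goals simp +contextual [eq_comm]

lemma sum_smul_lax_apply (c η : ℂ) (K : Matrix (Fin 3) (Fin 3) ℂ) (i k : Fin 3) :
    ∑ j, K i j • lax c η j k
      = (c * K i k) • 1 + η • Matrix.of fun p q => if p = k then K i q else 0 := by
  ext p q
  simp only [lax, Matrix.sum_apply, Matrix.smul_apply, Matrix.add_apply, smul_eq_mul,
    Matrix.single_apply, Matrix.of_apply, Fin.sum_univ_three]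
  fin_cases k <;> fin_cases p <;> fin_cases q <;> simp <;> ring

lemma wedgeTrace_lax (η : ℂ) (K : Matrix (Fin 3) (Fin 3) ℂ) :
    wedgeTrace (fun i k => ∑ j, K i j • lax (-η) η j k)
      (fun i k => ∑ j, K i j • lax (-(2 * η)) η j k) = (2 * η ^ 2) • K.adjugate := by
  rw [funext₂ (sum_smul_lax_apply (-η) η K), funext₂ (sum_smul_lax_apply (-(2 * η)) η K),
    wedgeTrace, Matrix.adjugate_fin_three]
  ext p q
  simp only [Fin.sum_univ_three, Matrix.smul_apply, Matrix.sub_apply,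
    Matrix.mul_apply, Matrix.add_apply, Matrix.of_apply, smul_eq_mul, Matrix.one_apply]
  fin_cases p <;> fin_cases q <;> simp <;> ring

end
end SoV

namespace SoV
noncomputable section
variable {N : ℕ} {η : ℂ} {K : Matrix (Fin 3) (Fin 3) ℂ}

lemma MPL.T1_asymptotic (η : ℂ) (K : Matrix (Fin 3) (Fin 3) ℂ) (a : Fin N) :
    MPL (fun t => SoV.T1 η (fun m : Fin N => (m : ℂ) * t) K ((a : ℂ) * t))
      (∑ n, if n = a then 0 else 1) (site a ((totalSpacing a * η) • K)) := by
  have := MPL.T1 (K := K) (ξ := fun t (m : Fin N) => (m : ℂ) * t) (lam := fun t => (a : ℂ) * t + 0)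
    fun n => MPL.Raux_asymptotic (η := η) a n 0
  simp only [ent_asymptotic, ← Finset.smul_sum, ← map_sum, sum_smul_lax, add_zero] at this
  rwa [← map_smul, smul_smul] at this

lemma MPL.T2_asymptotic (η : ℂ) (K : Matrix (Fin 3) (Fin 3) ℂ) (a : Fin N) :
    MPL (fun t => SoV.T2 η (fun m : Fin N => (m : ℂ) * t) K ((a : ℂ) * t - η))
      ((∑ n, if n = a then 0 else 1) + ∑ n, if n = a then 0 else 1)
      (site a ((totalSpacing a ^ 2 * (2 * η ^ 2)) • K.adjugate)) := by
  have := MPL.T2 (K := K) (ξ := fun t (m : Fin N) => (m : ℂ) * t)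
    (lam := fun t => (a : ℂ) * t - η)
    (fun n => by simpa only [sub_eq_add_neg] using MPL.Raux_asymptotic (η := η) a n (-η))
    (fun n => by
      have e : ∀ t : ℂ, (a : ℂ) * t - η - η = (a : ℂ) * t + -(2 * η) := fun t => by ring
      simpa only [e] using MPL.Raux_asymptotic (η := η) a n (-(2 * η)))
  convert this using 1
  rw [funext₂ (ent_asymptotic a (-η)), funext₂ (ent_asymptotic a (-(2 * η))), mul_smul,
    ← wedgeTrace_lax]
  simp only [wedgeTrace, map_smul, map_sum, map_sub, map_mul, smul_mul_smul_comm, ← smul_sub,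
    ← Finset.smul_sum]
  rw [smul_comm, pow_two]

/-- The single-site factors of the leading coefficients of the SoV charges. -/
def asymptoticFactor (η : ℂ) (K : Matrix (Fin 3) (Fin 3) ℂ) (a : Fin N) :
    Fin 3 → Matrix (Fin 3) (Fin 3) ℂ :=
  ![(totalSpacing a ^ 2 * (2 * η ^ 2)) • K.adjugate, 1, (totalSpacing a * η) • K]

lemma MPL.sovCovOp_asymptotic (η : ℂ) (K : Matrix (Fin 3) (Fin 3) ℂ) (h : St N) :
    ∃ d, MPL (fun t => sovCovOp η (fun m : Fin N => (m : ℂ) * t) K h) d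
      (tens fun a => asymptoticFactor η K a (h a)) := by
  have key : ∀ (a : Fin N) (p : Fin 3), ∃ d, MPL (fun t =>
      SoV.T2 η (fun m : Fin N => (m : ℂ) * t) K ((a : ℂ) * t - η) ^ (if p = 0 then 1 else 0) *
      SoV.T1 η (fun m : Fin N => (m : ℂ) * t) K ((a : ℂ) * t) ^ (if p = 2 then 1 else 0)) d
      (site a (asymptoticFactor η K a p)) := by
    intro a p
    fin_cases p
    · exact ⟨_, by simpa [asymptoticFactor] using MPL.T2_asymptotic η K a⟩
    · exact ⟨0, by simpa [asymptoticFactor] using MPL.const (1 : Op N)⟩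
    · exact ⟨_, by simpa [asymptoticFactor] using MPL.T1_asymptotic η K a⟩
  choose d hd using key
  refine ⟨((List.finRange N).map fun a => d a (h a)).sum, ?_⟩
  rw [← tens_eq_list_prod]
  simp only [sovCovOp, List.ofFn_eq_map]
  exact MPL.list_prod (List.finRange N) fun a _ => hd a (h a)

/-- The tensor product co-vector with equal factors. -/
def productCov (x : Fin 3 → ℂ) : Hsp N := fun f => ∏ a, x (f a)

lemma vecMul_productCov_tens (x : Fin 3 → ℂ) (A : Fin N → Matrix (Fin 3) (Fin 3) ℂ) (g : St N) :
    Matrix.vecMul (productCov x) (tens A) g = ∏ a, Matrix.vecMul x (A a) (g a) := by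
  simp only [Matrix.vecMul, dotProduct, productCov, tens_apply, ← Finset.prod_mul_distrib,
    Finset.prod_univ_sum, Fintype.piFinset_univ]

lemma det_tens_ne_zero {A : Fin N → Matrix (Fin 3) (Fin 3) ℂ} (h : ∀ a, (A a).det ≠ 0) :
    (tens A).det ≠ 0 := by
  have : tens A * tens (fun a => (A a)⁻¹) = 1 := by
    rw [← map_mul, ← map_one tens]
    congr 1
    funext a
    exact Matrix.mul_nonsing_inv _ (isUnit_iff_ne_zero.2 (h a))
  have := congrArg Matrix.det this
  rw [Matrix.det_mul, Matrix.det_one] at this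
  exact left_ne_zero_of_mul (this ▸ one_ne_zero)

lemma PL.det {ι : Type*} [Fintype ι] [DecidableEq ι] {F : ℂ → Matrix ι ι ℂ} {d : ι → ℕ}
    {C : Matrix ι ι ℂ} (h : ∀ i j, PL (fun t => F t i j) (d i) (C i j)) :
    PL (fun t => (F t).det) (∑ i, d i) C.det := by
  simp only [Matrix.det_apply']
  exact PL.sum fun σ _ => by
    have := (PL.prod (s := Finset.univ) fun i _ => h (σ i) i).const_mul (Equiv.Perm.sign σ : ℤ)
    rwa [Equiv.sum_comp σ d] at this

lemma det_asymptotic (x : Fin 3 → ℂ) (K : Matrix (Fin 3) (Fin 3) ℂ) (c₁ c₂ : ℂ) :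
    (Matrix.of fun p => Matrix.vecMul x
      ((![c₂ • K.adjugate, 1, c₁ • K] : Fin 3 → Matrix (Fin 3) (Fin 3) ℂ) p)).det
      = c₁ * c₂ * (Matrix.of ![x, Matrix.vecMul x K, Matrix.vecMul x (K * K)]).det := by
  rw [Matrix.det_fin_three, Matrix.det_fin_three, Matrix.adjugate_fin_three]
  simp [Matrix.vecMul, dotProduct, Fin.sum_univ_three, Matrix.mul_apply]
  ring

theorem exists_det_sovCov_ne_zero (hη : η ≠ 0) (x : Fin 3 → ℂ)
    (hx : (Matrix.of ![x, Matrix.vecMul x K, Matrix.vecMul x (K * K)]).det ≠ 0) :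
    ∃ ξ : Fin N → ℂ, (Matrix.of (sovCov η ξ K (productCov x)) : Op N).det ≠ 0 := by
  choose d hd using MPL.sovCovOp_asymptotic (N := N) η K
  have h1 : ∀ h g, PL (fun t => Matrix.of (sovCov η (fun m : Fin N => (m : ℂ) * t) K
      (productCov x)) h g) (d h)
      (tens (fun a => Matrix.of fun p => Matrix.vecMul x (asymptoticFactor η K a p)) h g) := by
    intro h g
    have e : tens (fun a => Matrix.of fun p => Matrix.vecMul x (asymptoticFactor η K a p)) h g
        = Matrix.vecMul (productCov x) (tens fun a => asymptoticFactor η K a (h a)) g := by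
      rw [vecMul_productCov_tens]
      rfl
    rw [e]
    simp only [Matrix.of_apply, sovCov, Matrix.vecMul, dotProduct]
    exact PL.sum fun f _ => (hd h f g).const_mul _
  obtain ⟨t, ht⟩ := (PL.det h1).ne_zero (det_tens_ne_zero fun a => by
    have ha := totalSpacing_ne_zero a
    rw [asymptoticFactor, det_asymptotic]
    simp [ha, hη, hx])
  exact ⟨_, ht⟩

end
end SoV

namespace SoV
noncomputable section

section MultivariatePolynomials

variable {σ ι κ τ : Type*}

/-- `f` is a polynomial function of several variables. -/
def IsMP (f : (σ → ℂ) → ℂ) : Prop := ∃ P : MvPolynomial σ ℂ, ∀ p, MvPolynomial.eval p P = f p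

lemma IsMP.const (c : ℂ) : IsMP fun _ : σ → ℂ => c := ⟨MvPolynomial.C c, by simp⟩

lemma IsMP.coord (i : σ) : IsMP fun p : σ → ℂ => p i := ⟨MvPolynomial.X i, by simp⟩

lemma IsMP.add {f g : (σ → ℂ) → ℂ} (hf : IsMP f) (hg : IsMP g) : IsMP fun p => f p + g p := by
  obtain ⟨P, hP⟩ := hf
  obtain ⟨Q, hQ⟩ := hg
  exact ⟨P + Q, by simp [hP, hQ]⟩

lemma IsMP.mul {f g : (σ → ℂ) → ℂ} (hf : IsMP f) (hg : IsMP g) : IsMP fun p => f p * g p := by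
  obtain ⟨P, hP⟩ := hf
  obtain ⟨Q, hQ⟩ := hg
  exact ⟨P * Q, by simp [hP, hQ]⟩

lemma IsMP.sub {f g : (σ → ℂ) → ℂ} (hf : IsMP f) (hg : IsMP g) : IsMP fun p => f p - g p := by
  obtain ⟨P, hP⟩ := hf
  obtain ⟨Q, hQ⟩ := hg
  exact ⟨P - Q, by simp [hP, hQ]⟩

lemma IsMP.sum {s : Finset ι} {f : ι → (σ → ℂ) → ℂ} (h : ∀ i, IsMP (f i)) :
    IsMP fun p => ∑ i ∈ s, f i p := by
  choose P hP using h
  exact ⟨∑ i ∈ s, P i, by simp [hP]⟩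

lemma IsMP.prod {s : Finset ι} {f : ι → (σ → ℂ) → ℂ} (h : ∀ i, IsMP (f i)) :
    IsMP fun p => ∏ i ∈ s, f i p := by
  choose P hP using h
  exact ⟨∏ i ∈ s, P i, by simp [hP]⟩

lemma IsMP.exists_ne_zero {f g : (σ → ℂ) → ℂ} (hf : IsMP f) (hg : IsMP g) {p q : σ → ℂ}
    (hp : f p ≠ 0) (hq : g q ≠ 0) :
    ∃ P : MvPolynomial σ ℂ, P ≠ 0 ∧ ∀ r, MvPolynomial.eval r P = f r * g r := by
  obtain ⟨P, hP⟩ := hf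
  obtain ⟨Q, hQ⟩ := hg
  refine ⟨P * Q, mul_ne_zero ?_ ?_, by simp [hP, hQ]⟩
  · rintro rfl
    exact hp (by rw [← hP, map_zero])
  · rintro rfl
    exact hq (by rw [← hQ, map_zero])

/-- The entries of `F` are polynomial functions of several variables. -/
def IsMMP (F : (σ → ℂ) → Matrix ι κ ℂ) : Prop := ∀ i j, IsMP fun p => F p i j

lemma IsMMP.const (C : Matrix ι κ ℂ) : IsMMP fun _ : σ → ℂ => C := fun i j => IsMP.const (C i j)

lemma IsMMP.mul [Fintype κ] {F : (σ → ℂ) → Matrix ι κ ℂ} {G : (σ → ℂ) → Matrix κ τ ℂ}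
    (hF : IsMMP F) (hG : IsMMP G) : IsMMP fun p => F p * G p := fun i j => by
  simp only [Matrix.mul_apply]
  exact IsMP.sum fun k => (hF i k).mul (hG k j)

lemma IsMMP.sub {F G : (σ → ℂ) → Matrix ι κ ℂ} (hF : IsMMP F) (hG : IsMMP G) :
    IsMMP fun p => F p - G p := fun i j => (hF i j).sub (hG i j)

lemma IsMMP.smul {F : (σ → ℂ) → Matrix ι κ ℂ} (c : ℂ) (hF : IsMMP F) :
    IsMMP fun p => c • F p := fun i j => (IsMP.const c).mul (hF i j)

lemma IsMMP.sum {s : Finset τ} {F : τ → (σ → ℂ) → Matrix ι κ ℂ} (h : ∀ a, IsMMP (F a)) :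
    IsMMP fun p => ∑ a ∈ s, F a p := fun i j => by
  simp only [Matrix.sum_apply]
  exact IsMP.sum fun a => h a i j

lemma IsMMP.list_prod [Fintype ι] [DecidableEq ι] {F : τ → (σ → ℂ) → Matrix ι ι ℂ} (l : List τ)
    (h : ∀ a, IsMMP (F a)) : IsMMP fun p => (l.map fun a => F a p).prod := by
  induction l with
  | nil => exact IsMMP.const 1
  | cons a l ih =>
    simp only [List.map_cons, List.prod_cons]
    exact (h a).mul ih

lemma IsMMP.pow_ite [Fintype ι] [DecidableEq ι] {F : (σ → ℂ) → Matrix ι ι ℂ} (h : IsMMP F)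
    (P : Prop) [Decidable P] : IsMMP fun p => F p ^ (if P then 1 else 0) := by
  split_ifs
  · simpa using h
  · simpa using IsMMP.const 1

lemma IsMMP.det [Fintype ι] [DecidableEq ι] {F : (σ → ℂ) → Matrix ι ι ℂ} (h : IsMMP F) :
    IsMP fun p => (F p).det := by
  simp only [Matrix.det_apply']
  exact IsMP.sum fun s => (IsMP.const _).mul (IsMP.prod fun i => h (s i) i)

end MultivariatePolynomials

section Genericity

variable {N : ℕ} {η : ℂ} {K : Matrix (Fin 3) (Fin 3) ℂ} {σ : Type*}
  {ξ : (σ → ℂ) → Fin N → ℂ} {lam : (σ → ℂ) → ℂ} {L : (σ → ℂ) → Hsp N}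

lemma IsMMP.monodromy (hξ : ∀ n, IsMP fun p => ξ p n) (hlam : IsMP lam) :
    IsMMP fun p => SoV.monodromy η (ξ p) K (lam p) := by
  simp only [SoV.monodromy, List.ofFn_eq_map, ← List.map_reverse]
  refine (IsMMP.const _).mul (IsMMP.list_prod _ fun n i j => ?_)
  simp only [Raux, Matrix.of_apply]
  exact ((hlam.sub (hξ n)).mul (IsMP.const _)).add (IsMP.const _)

lemma IsMMP.ent {M : (σ → ℂ) → Matrix (Fin 3 × St N) (Fin 3 × St N) ℂ} (h : IsMMP M)
    (i j : Fin 3) : IsMMP fun p => SoV.ent (M p) i j := fun f g => h (i, f) (j, g)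

lemma IsMMP.T1 (hξ : ∀ n, IsMP fun p => ξ p n) (hlam : IsMP lam) :
    IsMMP fun p => SoV.T1 η (ξ p) K (lam p) := by
  simp only [T1_eq]
  exact IsMMP.sum fun i => (IsMMP.monodromy hξ hlam).ent i i

lemma IsMMP.T2 (hξ : ∀ n, IsMP fun p => ξ p n) (hlam : IsMP lam) :
    IsMMP fun p => SoV.T2 η (ξ p) K (lam p) := by
  have h1 := IsMMP.monodromy (η := η) (K := K) hξ hlam
  have h2 := IsMMP.monodromy (η := η) (K := K) hξ (hlam.sub (IsMP.const η))
  simp only [T2_eq, wedgeTrace]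
  exact IsMMP.smul _ <| IsMMP.sum fun i => IsMMP.sum fun k =>
    ((h1.ent i i).mul (h2.ent k k)).sub ((h1.ent k i).mul (h2.ent i k))

lemma IsMMP.sovCov (hξ : ∀ n, IsMP fun p => ξ p n) (hL : ∀ f, IsMP fun p => L p f) :
    IsMMP fun p => (Matrix.of (SoV.sovCov η (ξ p) K (L p)) : Op N) := fun h g => by
  have h1 : IsMMP fun p => sovCovOp η (ξ p) K h := by
    simp only [sovCovOp, List.ofFn_eq_map]
    exact IsMMP.list_prod _ fun n =>
      ((IsMMP.T2 hξ ((hξ n).sub (IsMP.const η))).pow_ite _).mul ((IsMMP.T1 hξ (hξ n)).pow_ite _)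
  simp only [Matrix.of_apply, SoV.sovCov, Matrix.vecMul, dotProduct]
  exact IsMP.sum fun f => (hL f).mul (h1 f g)

/-- A single good point makes the good points the complement of a proper algebraic subset. -/
theorem exists_polynomial_sov (hη : η ≠ 0) (hK : K.det = 0) (hξ : ∀ n, IsMP fun p => ξ p n)
    (hL : ∀ f, IsMP fun p => L p f) {p q : σ → ℂ}
    (hp : (Matrix.of (sovCov η (ξ p) K (L p)) : Op N).det ≠ 0) (hq : ξ q = 0) :
    ∃ P : MvPolynomial σ ℂ, P ≠ 0 ∧ ∀ r, InhomCond η (ξ r) → MvPolynomial.eval r P ≠ 0 →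
      IsBasisFamily (sovCov η (ξ r) K (L r)) ∧
      ∀ R0 : Hsp N, DualRef η (ξ r) K (L r) R0 →
        IsBasisFamily (sovVec η (ξ r) K R0) ∧
        (∀ h k : St N, pair (sovCov η (ξ r) K (L r) h) (sovVec η (ξ r) K R0 k) =
          if h = k then Nh η (ξ r) h else 0) ∧
        (1 : Op N) = ∑ h : St N,
          (Nh η (ξ r) h)⁻¹ • Matrix.vecMulVec (sovVec η (ξ r) K R0 h)
            (sovCov η (ξ r) K (L r) h) := by
  obtain ⟨P, hP, hP'⟩ := (IsMMP.sovCov (η := η) (K := K) hξ hL).det.exists_ne_zero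
    (g := fun r => ∏ a, ∏ b, (ξ r a - ξ r b - 2 * η)) (q := q)
    (IsMP.prod fun a => IsMP.prod fun b => ((hξ a).sub (hξ b)).sub (IsMP.const _)) hp
    (by simp [hq, hη])
  refine ⟨P, hP, fun r hr hr' => ?_⟩
  rw [hP'] at hr'
  have h2 := right_ne_zero_of_mul hr'
  simp only [Finset.prod_ne_zero_iff, Finset.mem_univ, true_imp_iff] at h2
  exact sov_of_det_ne_zero hη hr h2 hK (left_ne_zero_of_mul hr')

end Genericity
end
end SoV

namespace SoV
noncomputable section
variable {N : ℕ} {η : ℂ} {K : Matrix (Fin 3) (Fin 3) ℂ}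

section CyclicCovectors

open Polynomial

/-- A co-vector not annihilated by any maximal proper divisor of the characteristic polynomial
of `K` is cyclic for `K`. -/
lemma det_cyclic_ne_zero {x : Fin 3 → ℂ}
    (hx : ∀ r ∈ K.charpoly.roots,
      Matrix.vecMul x (aeval K (K.charpoly /ₘ (X - C r))) ≠ 0) :
    (Matrix.of ![x, Matrix.vecMul x K, Matrix.vecMul x (K * K)]).det ≠ 0 := by
  intro hdet
  obtain ⟨c, hc, hcx⟩ := Matrix.exists_vecMul_eq_zero_iff.2 hdet
  set p : ℂ[X] := C (c 2) * X ^ 2 + C (c 1) * X + C (c 0) with hp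
  have hp0 : p ≠ 0 := by
    intro h
    apply hc
    funext i
    have h0 := congrArg (coeff · 0) h
    have h1 := congrArg (coeff · 1) h
    have h2 := congrArg (coeff · 2) h
    simp [hp, coeff_X, coeff_C, coeff_X_pow] at h0 h1 h2
    fin_cases i <;> assumption
  have hpx : Matrix.vecMul x (aeval K p) = 0 := by
    rw [← hcx]
    simp only [hp, map_add, map_mul, aeval_C, aeval_X, Algebra.algebraMap_eq_smul_one,
      smul_mul_assoc, one_mul, Matrix.vecMul_add, Matrix.vecMul_smul, Matrix.vecMul_one, pow_two]
    funext j
    simp [Matrix.vecMul, dotProduct, Fin.sum_univ_three]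
    ring
  have hχ0 := K.charpoly_monic.ne_zero
  have hg : Matrix.vecMul x (aeval K (EuclideanDomain.gcd p K.charpoly)) = 0 := by
    rw [EuclideanDomain.gcd_eq_gcd_ab, map_add, map_mul, map_mul, Matrix.aeval_self_charpoly,
      zero_mul, add_zero, ← Matrix.vecMul_vecMul, hpx, Matrix.zero_vecMul]
  obtain ⟨e, he⟩ := EuclideanDomain.gcd_dvd_right p K.charpoly
  have he0 : e ≠ 0 := by
    rintro rfl
    exact hχ0 (by rw [he, mul_zero])
  have hg0 : EuclideanDomain.gcd p K.charpoly ≠ 0 := fun h => hχ0 (by rw [he, h, zero_mul])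
  have hdeg : 0 < e.natDegree := by
    have h1 : K.charpoly.natDegree = 3 := by simp
    have h2 := natDegree_le_of_dvd (EuclideanDomain.gcd_dvd_left p K.charpoly) hp0
    have h3 : p.natDegree ≤ 2 := natDegree_quadratic_le
    rw [he, natDegree_mul hg0 he0] at h1
    omega
  obtain ⟨r, hr⟩ := Complex.exists_root (natDegree_pos_iff_degree_pos.1 hdeg)
  obtain ⟨e', he'⟩ := dvd_iff_isRoot.2 hr
  have hroot : K.charpoly.IsRoot r := by
    rw [he]
    exact root_mul_left_of_isRoot _ hr
  refine hx r ((mem_roots hχ0).2 hroot) ?_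
  have hq : K.charpoly /ₘ (X - C r) = EuclideanDomain.gcd p K.charpoly * e' := by
    apply mul_left_cancel₀ (X_sub_C_ne_zero r)
    rw [mul_divByMonic_eq_iff_isRoot.2 hroot]
    conv_lhs => rw [he, he']
    ring
  rw [hq, map_mul, ← Matrix.vecMul_vecMul, hg, Matrix.zero_vecMul]

/-- A matrix with simple spectrum has a cyclic co-vector. -/
lemma SimpleSpectrum.exists_cyclic (hK : SimpleSpectrum K) :
    ∃ x : Fin 3 → ℂ, (Matrix.of ![x, Matrix.vecMul x K, Matrix.vecMul x (K * K)]).det ≠ 0 := by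
  set s : Finset (Submodule ℂ (Fin 3 → ℂ)) := K.charpoly.roots.toFinset.image fun r =>
    LinearMap.ker (aeval K (K.charpoly /ₘ (X - C r))).vecMulLinear with hs
  have htop : ⊤ ∉ s := by
    rw [hs, Finset.mem_image]
    rintro ⟨r, -, hr⟩
    have h0 : aeval K (K.charpoly /ₘ (X - C r)) = 0 := by
      rw [LinearMap.ker_eq_top] at hr
      refine Matrix.ext_of_single_vecMul fun i => ?_
      rw [Matrix.vecMul_zero]
      exact LinearMap.congr_fun hr _
    have h3 : K.charpoly.natDegree = 3 := by simp
    have hdeg := natDegree_divByMonic K.charpoly (monic_X_sub_C r)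
    rw [h3, natDegree_X_sub_C] at hdeg
    have := natDegree_le_of_dvd (minpoly.dvd ℂ K h0) (fun h => by simp [h] at hdeg)
    rw [hK, h3, hdeg] at this
    omega
  obtain ⟨x, hx⟩ := (Set.ne_univ_iff_exists_notMem _).1
    (Subspace.biUnion_ne_univ_of_top_notMem htop)
  refine ⟨x, det_cyclic_ne_zero fun r hr h => hx ?_⟩
  simp only [Set.mem_iUnion]
  exact ⟨_, Finset.mem_image_of_mem _ (Multiset.mem_toFinset.2 hr), h⟩

lemma det_cyclic_conj {W J : Matrix (Fin 3) (Fin 3) ℂ} (hW : IsUnit W.det) (v : Fin 3 → ℂ)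
    (hv : (Matrix.of ![v, Matrix.vecMul v J, Matrix.vecMul v (J * J)]).det ≠ 0) :
    (Matrix.of ![Matrix.vecMul v W⁻¹, Matrix.vecMul (Matrix.vecMul v W⁻¹) (W * J * W⁻¹),
      Matrix.vecMul (Matrix.vecMul v W⁻¹) (W * J * W⁻¹ * (W * J * W⁻¹))]).det ≠ 0 := by
  have h1 : W⁻¹ * (W * J * W⁻¹) = J * W⁻¹ := by
    rw [mul_assoc, Matrix.nonsing_inv_mul_cancel_left _ _ hW]
  have h2 : W⁻¹ * (W * J * W⁻¹ * (W * J * W⁻¹)) = J * J * W⁻¹ := by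
    rw [← mul_assoc, h1, mul_assoc, h1, mul_assoc]
  have e : Matrix.of ![Matrix.vecMul v W⁻¹, Matrix.vecMul (Matrix.vecMul v W⁻¹) (W * J * W⁻¹),
      Matrix.vecMul (Matrix.vecMul v W⁻¹) (W * J * W⁻¹ * (W * J * W⁻¹))]
      = Matrix.of ![v, Matrix.vecMul v J, Matrix.vecMul v (J * J)] * W⁻¹ := by
    rw [Matrix.vecMul_vecMul, Matrix.vecMul_vecMul, h1, h2, ← Matrix.vecMul_vecMul,
      ← Matrix.vecMul_vecMul]
    ext i j
    fin_cases i <;> rfl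
  rw [e, Matrix.det_mul]
  exact mul_ne_zero hv (Matrix.isUnit_nonsing_inv_det W hW).ne_zero

lemma det_cyclic_KJmat_ne_zero {k₀ k₁ k₂ y₁ y₂ x y z : ℂ}
    (h : (k₀ ≠ k₁ ∧ k₀ ≠ k₂ ∧ k₁ ≠ k₂ ∧ y₁ = 0 ∧ y₂ = 0 ∧ x * y * z ≠ 0) ∨
       (k₀ = k₁ ∧ k₀ ≠ k₂ ∧ y₁ = 1 ∧ y₂ = 0 ∧ x * z ≠ 0) ∨
       (k₀ = k₁ ∧ k₁ = k₂ ∧ y₁ = 1 ∧ y₂ = 1 ∧ x ≠ 0)) :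
    (Matrix.of ![![x, y, z], Matrix.vecMul ![x, y, z] (KJmat k₀ k₁ k₂ y₁ y₂),
      Matrix.vecMul ![x, y, z] (KJmat k₀ k₁ k₂ y₁ y₂ * KJmat k₀ k₁ k₂ y₁ y₂)]).det ≠ 0 := by
  have e : ∀ d d' : ℂ, d' ≠ 0 → d = d' → d ≠ 0 := fun d d' h h' => h' ▸ h
  rcases h with ⟨h1, h2, h3, rfl, rfl, h4⟩ | ⟨rfl, h1, rfl, rfl, h4⟩ | ⟨rfl, rfl, rfl, rfl, h4⟩
  · refine e _ (x * y * z * ((k₁ - k₀) * (k₂ - k₀) * (k₂ - k₁))) (mul_ne_zero h4 (mul_ne_zero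
      (mul_ne_zero (sub_ne_zero.2 h1.symm) (sub_ne_zero.2 h2.symm)) (sub_ne_zero.2 h3.symm))) ?_
    simp [KJmat, Matrix.det_fin_three]
    ring
  · refine e _ (x * (x * z) * (k₂ - k₀) ^ 2) (mul_ne_zero (mul_ne_zero
      (left_ne_zero_of_mul h4) h4) (pow_ne_zero 2 (sub_ne_zero.2 h1.symm))) ?_
    simp [KJmat, Matrix.det_fin_three]
    ring
  · refine e _ (x ^ 3) (pow_ne_zero 3 h4) ?_
    simp [KJmat, Matrix.det_fin_three]
    ring

end CyclicCovectors
end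
end SoV

namespace SoV
noncomputable section

/-- for a simple-spectrum twist `K̂` with one zero eigenvalue (`det K̂ = 0`),
for all choices of `⟨1|` and of the inhomogeneities outside a proper algebraic subset the
SoV co-vectors and vectors form bases (in particular `⟨1|` may be of tensor product form
with the case-wise conditions), and these bases are mutually orthogonal with diagonal
couplings `N_h`; equivalently `Id = Σ_h |h⟩⟨h| / N_h`. -/
theorem statement_6 (N : ℕ) (hN : 1 ≤ N) (η : ℂ) (hη : η ≠ 0)
    (Khat : Matrix (Fin 3) (Fin 3) ℂ) (hK : SimpleSpectrum Khat) (hdet : Khat.det = 0) :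
    (∃ P : MvPolynomial (St N ⊕ Fin N) ℂ, P ≠ 0 ∧
      ∀ (L : Hsp N) (ξ : Fin N → ℂ), InhomCond η ξ →
        MvPolynomial.eval (Sum.elim L ξ) P ≠ 0 →
        IsBasisFamily (sovCov η ξ Khat L) ∧
        ∀ R0 : Hsp N, DualRef η ξ Khat L R0 →
          IsBasisFamily (sovVec η ξ Khat R0) ∧
          (∀ h k : St N,
            pair (sovCov η ξ Khat L h) (sovVec η ξ Khat R0 k) =
              if h = k then Nh η ξ h else 0) ∧
          (1 : Op N) = ∑ h : St N,
            (Nh η ξ h)⁻¹ • Matrix.vecMulVec (sovVec η ξ Khat R0 h) (sovCov η ξ Khat L h)) ∧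
    (∀ (W : Matrix (Fin 3) (Fin 3) ℂ) (k₀ k₁ k₂ y₁ y₂ x y z : ℂ),
      JordanData Khat W k₀ k₁ k₂ y₁ y₂ →
      ((k₀ ≠ k₁ ∧ k₀ ≠ k₂ ∧ k₁ ≠ k₂ ∧ y₁ = 0 ∧ y₂ = 0 ∧ x * y * z ≠ 0) ∨
       (k₀ = k₁ ∧ k₀ ≠ k₂ ∧ y₁ = 1 ∧ y₂ = 0 ∧ x * z ≠ 0) ∨
       (k₀ = k₁ ∧ k₁ = k₂ ∧ y₁ = 1 ∧ y₂ = 1 ∧ x ≠ 0)) →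
      ∃ Q : MvPolynomial (Fin N) ℂ, Q ≠ 0 ∧
        ∀ ξ : Fin N → ℂ, InhomCond η ξ → MvPolynomial.eval ξ Q ≠ 0 →
          IsBasisFamily (sovCov η ξ Khat (tensorCov W x y z)) ∧
          ∀ R0 : Hsp N, DualRef η ξ Khat (tensorCov W x y z) R0 →
            IsBasisFamily (sovVec η ξ Khat R0) ∧
            (∀ h k : St N,
              pair (sovCov η ξ Khat (tensorCov W x y z) h) (sovVec η ξ Khat R0 k) =
                if h = k then Nh η ξ h else 0) ∧
            (1 : Op N) = ∑ h : St N,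
              (Nh η ξ h)⁻¹ •
                Matrix.vecMulVec (sovVec η ξ Khat R0 h)
                  (sovCov η ξ Khat (tensorCov W x y z) h)) := by
  constructor
  · obtain ⟨x, hx⟩ := hK.exists_cyclic
    obtain ⟨ξ₀, hξ₀⟩ := exists_det_sovCov_ne_zero (N := N) hη x hx
    obtain ⟨P, hP, h⟩ := exists_polynomial_sov (σ := St N ⊕ Fin N)
      (ξ := fun p n => p (Sum.inr n)) (L := fun p f => p (Sum.inl f)) hη hdet
      (fun n => IsMP.coord _) (fun f => IsMP.coord _)
      (p := Sum.elim (productCov x) ξ₀) (q := 0) hξ₀ rfl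
    exact ⟨P, hP, fun L ξ => h (Sum.elim L ξ)⟩
  · rintro W k₀ k₁ k₂ y₁ y₂ x y z ⟨hW, rfl⟩ hxyz
    obtain ⟨ξ₀, hξ₀⟩ := exists_det_sovCov_ne_zero (N := N) hη _
      (det_cyclic_conj hW ![x, y, z] (det_cyclic_KJmat_ne_zero hxyz))
    exact exists_polynomial_sov (σ := Fin N) (ξ := fun p => p)
      (L := fun _ => tensorCov W x y z) hη hdet
      (fun n => IsMP.coord _) (fun f => IsMP.const _) (p := ξ₀) (q := 0) hξ₀ rfl

end
end SoV
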